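/- Assume f satisfies assumption (A). There exist ρ, M > 0 such that for any ε₀ ∈ (0, 1/2), any integer k ≥ 0 and any ω ∈ J_k(ε₀), setting ν_n = √(1 − n²ω²) for |n| ≤ k, there exist maps Ω^u, Ω^s defined on {a = (a_{−k},…,a_k) ∈ ℂ^{2k+1} : a_{−n} = conj(a_n), |a|₁ := Σ_{n=−k}^{k}|a_n| < ρ·ν_k}, of the form Ω^⋆(a,τ) = ( Σ_{|n|≤k} a_n e^{inτ} + Ω₁^⋆(a,τ), Σ_{|n|≤k}(∓ν_n)·a_n e^{inτ} + Ω₂^⋆(a,τ) ) (sign − for ⋆ = s and + for ⋆ = u), with values in pairs of 2π-periodic functions of τ, such that: (i) Ω^⋆(0,·) = 0; (ii) ‖Ω₁^⋆(a,·) − Ω₁^⋆(ã,·)‖_{ℓ₁} + ν_k^{−1}·‖Ω₂^⋆(a,·) − Ω₂^⋆(ã,·)‖_{ℓ₁} ≤ M·ν_k^{−2}·(|a|₁² + |ã|₁²)·|a − ã|₁ for all admissible a, ã; and (iii) for each admissible a, Ω^s(a,·) equals (u(0,·), ∂_x u(0,·)) for a solution u(x,τ) of ω²∂_τ²u − ∂_x²u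 + u − (1/3)u³ − f(u) = 0 on x ∈ [0,∞), 2π-periodic in τ, satisfying sup_{x≥0} e^{ν_k x}·‖u(x,·)‖_{ℓ₁} < ∞ (so u(x,·) → 0 as x → +∞), and analogously Ω^u(a,·) gives data of a solution on x ∈ (−∞,0] decaying exponentially at rate ν_k as x → −∞. -/

import Mathlib

open Complex Filter MeasureTheory Topology Asymptotics
open scoped ENNReal

noncomputable section

/-- Assumption (A): `f` is (the complex-analytic extension of) a real-analytic odd function
near `0` with `f(u) = O(u⁵)` as `u → 0`. -/
def AssumptionA (f : ℂ → ℂ) : Prop :=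
  AnalyticAt ℂ f 0 ∧ (∀ z, f (-z) = - f z) ∧ (∀ x : ℝ, (f (x : ℂ)).im = 0) ∧
    f =O[nhds (0 : ℂ)] fun z => z ^ 5

/-- The frequency intervals `J_k(ε₀)`: `J₀(ε₀) = [1,∞)` and, for `k ≥ 1`,
`J_k(ε₀) = [1/(k+1), (k(k+ε₀²))^{−1/2})`. -/
def Jset (ε₀ : ℝ) (k : ℕ) : Set ℝ :=
  if k = 0 then Set.Ici 1
  else Set.Ico (1 / ((k : ℝ) + 1)) (1 / Real.sqrt (k * (k + ε₀ ^ 2)))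

/-- `u` solves `ω²∂_τ²u − ∂_x²u + u − (1/3)u³ − f(u) = 0` for `x ∈ S`
(the Klein–Gordon equation in the rescaled time `τ = ωt`). -/
def IsTauKGSolutionOn (f : ℂ → ℂ) (ω : ℝ) (S : Set ℝ) (u : ℝ → ℝ → ℝ) : Prop :=
  ∀ x ∈ S, ∀ τ : ℝ,
    ω ^ 2 * deriv (fun s => deriv (fun s' => u x s') s) τ
      - deriv (fun s => deriv (fun s' => u s' τ) s) x
      + u x τ - (1 / 3) * u x τ ^ 3 - (f (u x τ)).re = 0

/-- The `n`-th Fourier coefficient of a `2π`-periodic function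
(`w(τ) = Σ_{n∈ℤ} w_n e^{inτ}`). -/
def eCoeff (w : ℝ → ℂ) (n : ℤ) : ℂ :=
  (1 / (2 * Real.pi) : ℂ) *
    ∫ τ in (0 : ℝ)..(2 * Real.pi), w τ * Complex.exp (-(Complex.I * (n : ℂ) * (τ : ℂ)))

/-- `ℓ₁` norm of the `2π`-Fourier coefficients of a complex-valued function. -/
def l1C (w : ℝ → ℂ) : ℝ≥0∞ := ∑' n : ℤ, (‖eCoeff w n‖₊ : ℝ≥0∞)

/-- `ℓ₁` norm of the `2π`-Fourier coefficients of a real-valued function. -/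
def l1R (w : ℝ → ℝ) : ℝ≥0∞ := l1C fun τ => (w τ : ℂ)

/-- The hyperbolic eigenvalues `ν_n = √(1 − n²ω²)`. -/
def nuKG (ω : ℝ) (n : ℤ) : ℝ := Real.sqrt (1 - (n : ℝ) ^ 2 * ω ^ 2)

/-- `|a|₁ = Σ_{|n|≤k} |a_n|`. -/
def aNorm (k : ℕ) (a : ℤ → ℂ) : ℝ := ∑ n ∈ Finset.Icc (-(k : ℤ)) (k : ℤ), ‖a n‖

/-- Admissible parameters `a = (a_{−k},…,a_k) ∈ ℂ^{2k+1}` with `a_{−n} = conj(a_n)` and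
`|a|₁ < r`. -/
def Adm (k : ℕ) (r : ℝ) (a : ℤ → ℂ) : Prop :=
  (∀ n : ℤ, a (-n) = starRingEnd ℂ (a n)) ∧ (∀ n : ℤ, (k : ℤ) < |n| → a n = 0) ∧
    aNorm k a < r

/-- The linear part `Σ_{|n|≤k} c_n·a_n·e^{inτ}` of the parameterization. -/
def linPart (k : ℕ) (c : ℤ → ℝ) (a : ℤ → ℂ) (τ : ℝ) : ℂ :=
  ∑ n ∈ Finset.Icc (-(k : ℤ)) (k : ℤ),
    (c n : ℂ) * a n * Complex.exp (Complex.I * (n : ℂ) * (τ : ℂ))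

namespace KG

/-- bounded continuous functions on the line -/
abbrev B := BoundedContinuousFunction ℝ ℂ

/-- the sequence space -/
abbrev X := lp (fun _ : ℤ => B) 1

lemma X_hasSum (W : X) : HasSum (fun n => ‖W n‖) ‖W‖ := by
  have := lp.hasSum_norm (p := 1) (by simp) W
  simpa using this

lemma X_summable (W : X) : Summable (fun n => ‖W n‖) := (X_hasSum W).summable

/-- build an element from a summable sequence -/
def mkX (w : ℤ → B) (h : Summable fun n => ‖w n‖) : X :=
  ⟨w, memℓp_gen (by simpa using h)⟩

lemma mkX_apply (w : ℤ → B) (h : Summable fun n => ‖w n‖) (n : ℤ) : mkX w h n = w n := rfl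

lemma X_norm_le (W : X) (b : ℤ → ℝ) (C : ℝ) (hb : HasSum b C) (h : ∀ n, ‖W n‖ ≤ b n) : ‖W‖ ≤ C :=
  hasSum_le h (X_hasSum W) hb

lemma X_ext {W Z : X} (h : ∀ n y, W n y = Z n y) : W = Z := by
  apply lp.ext
  funext n
  ext y
  exact h n y

/-- weights -/
def cw (σ : ℝ) (j l : ℤ) : ℝ := Real.exp (σ * (|(j + l : ℤ)| - |j| - |l| : ℤ))

lemma cw_nonneg (σ : ℝ) (j l : ℤ) : 0 ≤ cw σ j l := (Real.exp_pos _).le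

lemma cw_le (σ : ℝ) (hσ : 0 ≤ σ) (j l : ℤ) : cw σ j l ≤ 1 := by
  unfold cw
  rw [Real.exp_le_one_iff]
  have : (|(j + l : ℤ)| - |j| - |l| : ℤ) ≤ 0 := by
    have := abs_add_le j l
    linarith
  have : ((|(j + l : ℤ)| - |j| - |l| : ℤ) : ℝ) ≤ 0 := by exact_mod_cast this
  exact mul_nonpos_of_nonneg_of_nonpos hσ this

/-- reindexing -/
def sh : ℤ × ℤ ≃ ℤ × ℤ where
  toFun p := (p.2, p.1 - p.2)
  invFun p := (p.1 + p.2, p.1)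
  left_inv p := by ext <;> simp
  right_inv p := by ext <;> simp

lemma conv_hasSum {R : Type*} [NormedCommRing R] [CompleteSpace R] {f g : ℤ → R} {a b : R}
    (hf : HasSum f a) (hg : HasSum g b)
    (hf' : Summable fun n => ‖f n‖) (hg' : Summable fun n => ‖g n‖) :
    HasSum (fun p : ℤ × ℤ => f p.2 * g (p.1 - p.2)) (a * b) := by
  have h1 : HasSum (fun p : ℤ × ℤ => f p.1 * g p.2) (a * b) :=
    hf.mul hg (summable_mul_of_summable_norm hf' hg')
  exact (sh.hasSum_iff (f := fun p : ℤ × ℤ => f p.1 * g p.2)).2 h1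

lemma conv_norm_hasSum (W Z : X) :
    HasSum (fun p : ℤ × ℤ => ‖W p.2‖ * ‖Z (p.1 - p.2)‖) (‖W‖ * ‖Z‖) :=
  conv_hasSum (R := ℝ) (f := fun n => ‖W n‖) (g := fun n => ‖Z n‖) (X_hasSum W) (X_hasSum Z)
    (by simpa only [norm_norm] using X_summable W) (by simpa only [norm_norm] using X_summable Z)

lemma cterm_le (σ : ℝ) (hσ : 0 ≤ σ) (W Z : X) (n j : ℤ) :
    ‖((cw σ j (n - j) : ℝ) : ℂ) • (W j * Z (n - j))‖ ≤ ‖W j‖ * ‖Z (n - j)‖ := by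
  rw [norm_smul]
  have h1 : ‖((cw σ j (n - j) : ℝ) : ℂ)‖ ≤ 1 := by
    rw [Complex.norm_real, Real.norm_of_nonneg (cw_nonneg _ _ _)]
    exact cw_le _ hσ _ _
  calc _ ≤ 1 * ‖W j * Z (n - j)‖ := by gcongr
    _ ≤ _ := by rw [one_mul]; exact norm_mul_le _ _

lemma cterm_summable_norm (σ : ℝ) (hσ : 0 ≤ σ) (W Z : X) (n : ℤ) :
    Summable fun j => ‖((cw σ j (n - j) : ℝ) : ℂ) • (W j * Z (n - j))‖ :=
  Summable.of_nonneg_of_le (fun _ => norm_nonneg _) (cterm_le σ hσ W Z n)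
    ((conv_norm_hasSum W Z).summable.prod_factor n)

lemma cterm_summable (σ : ℝ) (hσ : 0 ≤ σ) (W Z : X) (n : ℤ) :
    Summable fun j => ((cw σ j (n - j) : ℝ) : ℂ) • (W j * Z (n - j)) :=
  (cterm_summable_norm σ hσ W Z n).of_norm

/-- coefficients of the product -/
def cfun (σ : ℝ) (W Z : X) (n : ℤ) : B := ∑' j, ((cw σ j (n - j) : ℝ) : ℂ) • (W j * Z (n - j))

lemma cfun_norm_le (σ : ℝ) (hσ : 0 ≤ σ) (W Z : X) (n : ℤ) :
    ‖cfun σ W Z n‖ ≤ ∑' j, ‖W j‖ * ‖Z (n - j)‖ :=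
  tsum_of_norm_bounded ((conv_norm_hasSum W Z).summable.prod_factor n).hasSum
    (cterm_le σ hσ W Z n)

lemma cbound_hasSum (W Z : X) :
    HasSum (fun n => ∑' j, ‖W j‖ * ‖Z (n - j)‖) (‖W‖ * ‖Z‖) :=
  (conv_norm_hasSum W Z).prod_fiberwise
    (fun n => ((conv_norm_hasSum W Z).summable.prod_factor n).hasSum)

lemma cfun_summable (σ : ℝ) (hσ : 0 ≤ σ) (W Z : X) : Summable fun n => ‖cfun σ W Z n‖ :=
  Summable.of_nonneg_of_le (fun _ => norm_nonneg _) (cfun_norm_le σ hσ W Z)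
    (cbound_hasSum W Z).summable

/-- product -/
def cv (σ : ℝ) (hσ : 0 ≤ σ) (W Z : X) : X := mkX (cfun σ W Z) (cfun_summable σ hσ W Z)

lemma cv_norm_le (σ : ℝ) (hσ : 0 ≤ σ) (W Z : X) : ‖cv σ hσ W Z‖ ≤ ‖W‖ * ‖Z‖ :=
  X_norm_le _ _ _ (cbound_hasSum W Z) (cfun_norm_le σ hσ W Z)

lemma cv_sub_left (σ : ℝ) (hσ : 0 ≤ σ) (W W' Z : X) :
    cv σ hσ (W - W') Z = cv σ hσ W Z - cv σ hσ W' Z := by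
  apply lp.ext
  funext n
  change cfun σ (W - W') Z n = cfun σ W Z n - cfun σ W' Z n
  unfold cfun
  rw [← (cterm_summable σ hσ W Z n).tsum_sub (cterm_summable σ hσ W' Z n)]
  refine tsum_congr fun j => ?_
  change _ • ((W j - W' j) * _) = _
  rw [sub_mul, smul_sub]

lemma cv_sub_right (σ : ℝ) (hσ : 0 ≤ σ) (W Z Z' : X) :
    cv σ hσ W (Z - Z') = cv σ hσ W Z - cv σ hσ W Z' := by
  apply lp.ext
  funext n
  change cfun σ W (Z - Z') n = cfun σ W Z n - cfun σ W Z' n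
  unfold cfun
  rw [← (cterm_summable σ hσ W Z n).tsum_sub (cterm_summable σ hσ W Z' n)]
  refine tsum_congr fun j => ?_
  change _ • (_ * (Z (n - j) - Z' (n - j))) = _
  rw [mul_sub, smul_sub]

/-- evaluation weights -/
def ew (σ τ : ℝ) (n : ℤ) : ℂ :=
  (Real.exp (-(σ * (|n| : ℤ))) : ℂ) * Complex.exp (Complex.I * (n : ℂ) * (τ : ℂ))

lemma norm_cexp (n : ℤ) (τ : ℝ) : ‖Complex.exp (Complex.I * (n : ℂ) * (τ : ℂ))‖ = 1 := by
  have : Complex.I * (n : ℂ) * (τ : ℂ) = ((n * τ : ℝ) : ℂ) * Complex.I := by push_cast; ring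
  rw [this, Complex.norm_exp_ofReal_mul_I]

lemma ew_norm (σ τ : ℝ) (n : ℤ) : ‖ew σ τ n‖ = Real.exp (-(σ * (|n| : ℤ))) := by
  unfold ew
  rw [norm_mul, norm_cexp, mul_one, Complex.norm_real, Real.norm_of_nonneg (Real.exp_pos _).le]

lemma ew_norm_le (σ : ℝ) (hσ : 0 ≤ σ) (τ : ℝ) (n : ℤ) : ‖ew σ τ n‖ ≤ 1 := by
  rw [ew_norm, Real.exp_le_one_iff, neg_nonpos]
  exact mul_nonneg hσ (by exact_mod_cast abs_nonneg n)

lemma ew_mul (σ τ : ℝ) (j l : ℤ) : (cw σ j l : ℂ) * ew σ τ (j + l) = ew σ τ j * ew σ τ l := by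
  unfold ew cw
  have e1 : Real.exp (σ * (|(j + l : ℤ)| - |j| - |l| : ℤ)) * Real.exp (-(σ * (|j + l| : ℤ)))
      = Real.exp (-(σ * (|j| : ℤ))) * Real.exp (-(σ * (|l| : ℤ))) := by
    rw [← Real.exp_add, ← Real.exp_add]; congr 1; push_cast; ring
  have e2 : Complex.exp (Complex.I * ((j + l : ℤ) : ℂ) * (τ : ℂ))
      = Complex.exp (Complex.I * (j : ℂ) * (τ : ℂ)) * Complex.exp (Complex.I * (l : ℂ) * (τ : ℂ)) := by
    rw [← Complex.exp_add]; congr 1; push_cast; ring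
  rw [e2, ← mul_assoc, ← Complex.ofReal_mul, e1]
  push_cast; ring

lemma et_le (σ : ℝ) (hσ : 0 ≤ σ) (y τ : ℝ) (W : X) (n : ℤ) : ‖ew σ τ n * W n y‖ ≤ ‖W n‖ := by
  rw [norm_mul]
  calc _ ≤ 1 * ‖W n‖ := by
        gcongr
        · exact ew_norm_le σ hσ τ n
        · exact (W n).norm_coe_le_norm y
    _ = _ := one_mul _

lemma et_summable_norm (σ : ℝ) (hσ : 0 ≤ σ) (y τ : ℝ) (W : X) :
    Summable fun n => ‖ew σ τ n * W n y‖ :=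
  Summable.of_nonneg_of_le (fun _ => norm_nonneg _) (et_le σ hσ y τ W) (X_summable W)

/-- evaluation -/
def ev (σ : ℝ) (hσ : 0 ≤ σ) (y τ : ℝ) : X →L[ℂ] ℂ :=
  LinearMap.mkContinuous
    { toFun := fun W => ∑' n, ew σ τ n * W n y
      map_add' := by
        intro W Z
        rw [← (et_summable_norm σ hσ y τ W).of_norm.tsum_add (et_summable_norm σ hσ y τ Z).of_norm]
        refine tsum_congr fun n => ?_
        change _ * (W n y + Z n y) = _
        ring
      map_smul' := by
        intro c W
        rw [smul_eq_mul, ← tsum_mul_left]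
        refine tsum_congr fun n => ?_
        change _ * (c * W n y) = _
        simp only [RingHom.id_apply]
        ring } 1
    (by
      intro W
      rw [one_mul]
      exact tsum_of_norm_bounded (X_hasSum W) (et_le σ hσ y τ W))

lemma ev_apply (σ : ℝ) (hσ : 0 ≤ σ) (y τ : ℝ) (W : X) :
    ev σ hσ y τ W = ∑' n, ew σ τ n * W n y := rfl

lemma ev_norm_le (σ : ℝ) (hσ : 0 ≤ σ) (y τ : ℝ) (W : X) : ‖ev σ hσ y τ W‖ ≤ ‖W‖ :=
  tsum_of_norm_bounded (X_hasSum W) (et_le σ hσ y τ W)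

lemma ev_hasSum (σ : ℝ) (hσ : 0 ≤ σ) (y τ : ℝ) (W : X) :
    HasSum (fun n => ew σ τ n * W n y) (ev σ hσ y τ W) :=
  (et_summable_norm σ hσ y τ W).of_norm.hasSum

/-- coordinate evaluation -/
def cev (y : ℝ) : B →L[ℂ] ℂ := BoundedContinuousFunction.evalCLM ℂ y

lemma cev_apply (y : ℝ) (b : B) : cev y b = b y := rfl

lemma ev_cv (σ : ℝ) (hσ : 0 ≤ σ) (y τ : ℝ) (W Z : X) :
    ev σ hσ y τ (cv σ hσ W Z) = ev σ hσ y τ W * ev σ hσ y τ Z := by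
  have h := conv_hasSum (ev_hasSum σ hσ y τ W) (ev_hasSum σ hσ y τ Z)
    (et_summable_norm σ hσ y τ W) (et_summable_norm σ hσ y τ Z)
  have h2 := h.prod_fiberwise (fun n => (h.summable.prod_factor n).hasSum)
  rw [← h2.tsum_eq, ev_apply]
  refine tsum_congr fun n => ?_
  change ew σ τ n * cev y (cfun σ W Z n) = _
  unfold cfun
  rw [ContinuousLinearMap.map_tsum _ (cterm_summable σ hσ W Z n), ← tsum_mul_left]
  refine tsum_congr fun j => ?_
  have := ew_mul σ τ j (n - j)
  rw [add_sub_cancel] at this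
  change ew σ τ n * (cw σ j (n - j) * (W j y * Z (n - j) y)) = _
  calc _ = (cw σ j (n - j) * ew σ τ n) * (W j y * Z (n - j) y) := by ring
    _ = _ := by rw [this]; ring

/-- symmetric sequences (real functions) -/
def Sym (W : X) : Prop := ∀ n, W (-n) = star (W n)

lemma cw_neg (σ : ℝ) (j l : ℤ) : cw σ (-j) (-l) = cw σ j l := by
  unfold cw
  rw [← neg_add, abs_neg, abs_neg, abs_neg]

lemma Sym.cv {σ : ℝ} {hσ : 0 ≤ σ} {W Z : X} (hW : Sym W) (hZ : Sym Z) : Sym (cv σ hσ W Z) := by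
  intro n
  change cfun σ W Z (-n) = star (cfun σ W Z n)
  unfold cfun
  rw [tsum_star, ← (Equiv.neg ℤ).tsum_eq]
  refine tsum_congr fun j => ?_
  have : (-n - (Equiv.neg ℤ) j) = -(n - j) := by simp; ring
  rw [this]
  simp only [Equiv.neg_apply]
  rw [cw_neg, hW, hZ]
  ext y
  simp

lemma Sym.ev_im {σ : ℝ} {hσ : 0 ≤ σ} {W : X} (hW : Sym W) (y τ : ℝ) : (ev σ hσ y τ W).im = 0 := by
  rw [← Complex.conj_eq_iff_im, ev_apply, Complex.conj_tsum, ← (Equiv.neg ℤ).tsum_eq]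
  refine tsum_congr fun n => ?_
  simp only [Equiv.neg_apply]
  rw [hW n]
  unfold ew
  simp only [map_mul, ← Complex.exp_conj, Complex.conj_ofReal, Complex.conj_I, abs_neg]
  simp

end KG

namespace KG

/-- decaying weight -/
def qB (ν : ℝ) (hν : 0 ≤ ν) : B :=
  BoundedContinuousFunction.ofNormedAddCommGroup (fun y => ((Real.exp (-(ν * max y 0)) : ℝ) : ℂ))
    (by fun_prop) 1 (by
      intro y
      rw [Complex.norm_real, Real.norm_of_nonneg (Real.exp_pos _).le, Real.exp_le_one_iff,
        neg_nonpos]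
      positivity)

lemma qB_norm (ν : ℝ) (hν : 0 ≤ ν) : ‖qB ν hν‖ ≤ 1 :=
  BoundedContinuousFunction.norm_ofNormedAddCommGroup_le _ zero_le_one _

lemma qB_apply (ν : ℝ) (hν : 0 ≤ ν) (y : ℝ) :
    qB ν hν y = ((Real.exp (-(ν * max y 0)) : ℝ) : ℂ) := rfl

/-- multiplication by the weight -/
def qm (ν : ℝ) (hν : 0 ≤ ν) (W : X) : X := qB ν hν • W

lemma qm_apply (ν : ℝ) (hν : 0 ≤ ν) (W : X) (n : ℤ) : qm ν hν W n = qB ν hν * W n := rfl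

lemma qm_norm_le (ν : ℝ) (hν : 0 ≤ ν) (W : X) : ‖qm ν hν W‖ ≤ ‖W‖ := by
  calc _ ≤ ‖qB ν hν‖ * ‖W‖ := norm_smul_le _ _
    _ ≤ 1 * ‖W‖ := by gcongr; exact qB_norm ν hν
    _ = _ := one_mul _

lemma qm_sub (ν : ℝ) (hν : 0 ≤ ν) (W Z : X) : qm ν hν (W - Z) = qm ν hν W - qm ν hν Z :=
  smul_sub _ _ _

lemma Sym.qm {ν : ℝ} {hν : 0 ≤ ν} {W : X} (h : Sym W) : Sym (qm ν hν W) := by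
  intro n
  rw [qm_apply, qm_apply, h n]
  ext y
  simp [qB_apply, ← Complex.exp_conj]

lemma ev_qm (σ : ℝ) (hσ : 0 ≤ σ) (ν : ℝ) (hν : 0 ≤ ν) (y τ : ℝ) (W : X) :
    ev σ hσ y τ (qm ν hν W) = qB ν hν y * ev σ hσ y τ W := by
  rw [ev_apply, ev_apply, ← tsum_mul_left]
  refine tsum_congr fun n => ?_
  rw [qm_apply]
  simp only [BoundedContinuousFunction.coe_mul, Pi.mul_apply]
  ring

section
variable (σ : ℝ) (hσ : 0 ≤ σ) (ν : ℝ) (hν : 0 ≤ ν)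

/-- `q^m W^{m+3}` -/
def pw (W : X) : ℕ → X
  | 0 => cv σ hσ W (cv σ hσ W W)
  | m + 1 => qm ν hν (cv σ hσ W (pw W m))

lemma pw_norm_le (W : X) (m : ℕ) : ‖pw σ hσ ν hν W m‖ ≤ ‖W‖ ^ (m + 3) := by
  induction m with
  | zero =>
    calc _ ≤ ‖W‖ * ‖cv σ hσ W W‖ := cv_norm_le _ _ _ _
      _ ≤ ‖W‖ * (‖W‖ * ‖W‖) := by gcongr; exact cv_norm_le _ _ _ _
      _ = _ := by ring
  | succ m ih =>
    calc _ ≤ ‖cv σ hσ W (pw σ hσ ν hν W m)‖ := qm_norm_le _ _ _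
      _ ≤ ‖W‖ * ‖pw σ hσ ν hν W m‖ := cv_norm_le _ _ _ _
      _ ≤ ‖W‖ * ‖W‖ ^ (m + 3) := by gcongr
      _ = _ := by ring

lemma cv_diff (W Z P P' : X) :
    ‖cv σ hσ W P - cv σ hσ Z P'‖ ≤ ‖W‖ * ‖P - P'‖ + ‖W - Z‖ * ‖P'‖ := by
  have : cv σ hσ W P - cv σ hσ Z P' = cv σ hσ W (P - P') + cv σ hσ (W - Z) P' := by
    rw [cv_sub_left, cv_sub_right]; abel
  rw [this]
  exact (norm_add_le _ _).trans (add_le_add (cv_norm_le _ _ _ _) (cv_norm_le _ _ _ _))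

lemma pw_diff (W Z : X) (r : ℝ) (hW : ‖W‖ ≤ r) (hZ : ‖Z‖ ≤ r) (m : ℕ) :
    ‖pw σ hσ ν hν W m - pw σ hσ ν hν Z m‖ ≤ (m + 3) * r ^ (m + 2) * ‖W - Z‖ := by
  have hr : 0 ≤ r := (norm_nonneg _).trans hW
  induction m with
  | zero =>
    calc _ ≤ ‖W‖ * ‖cv σ hσ W W - cv σ hσ Z Z‖ + ‖W - Z‖ * ‖cv σ hσ Z Z‖ := cv_diff _ _ _ _ _ _
      _ ≤ r * (r * ‖W - Z‖ + ‖W - Z‖ * r) + ‖W - Z‖ * (r * r) := by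
        have h1 := cv_diff σ hσ W Z W Z
        have h2 : ‖W‖ * ‖W - Z‖ + ‖W - Z‖ * ‖Z‖ ≤ r * ‖W - Z‖ + ‖W - Z‖ * r := by gcongr
        have h3 : ‖cv σ hσ Z Z‖ ≤ r * r := (cv_norm_le _ _ _ _).trans (by gcongr)
        have h4 := h1.trans h2
        gcongr
      _ = _ := by push_cast; ring
  | succ m ih =>
    have h0 : pw σ hσ ν hν W (m + 1) - pw σ hσ ν hν Z (m + 1)
      = qm ν hν (cv σ hσ W (pw σ hσ ν hν W m) - cv σ hσ Z (pw σ hσ ν hν Z m)) := by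
      rw [qm_sub]; rfl
    rw [h0]
    have h3 : ‖pw σ hσ ν hν Z m‖ ≤ r ^ (m + 3) := (pw_norm_le _ _ _ _ _ _).trans (by gcongr)
    calc _ ≤ _ := qm_norm_le _ _ _
      _ ≤ _ := cv_diff _ _ _ _ _ _
      _ ≤ r * ((m + 3) * r ^ (m + 2) * ‖W - Z‖) + ‖W - Z‖ * r ^ (m + 3) := by gcongr
      _ = _ := by push_cast; ring

lemma ev_pw (y τ : ℝ) (W : X) (m : ℕ) :
    ev σ hσ y τ (pw σ hσ ν hν W m) = (qB ν hν y) ^ m * (ev σ hσ y τ W) ^ (m + 3) := by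
  induction m with
  | zero => simp only [pw, ev_cv]; ring
  | succ m ih => simp only [pw, ev_cv, ev_qm, ih]; ring

lemma Sym.pw {W : X} (h : Sym W) (m : ℕ) : Sym (pw σ hσ ν hν W m) := by
  induction m with
  | zero => exact h.cv (h.cv h)
  | succ m ih => exact (h.cv ih).qm

/-- the constant -/
def S0 : ℝ := ∑' m : ℕ, ((m : ℝ) + 3) * (1 / 2) ^ m

lemma S0_summable : Summable fun m : ℕ => ((m : ℝ) + 3) * (1 / 2 : ℝ) ^ m := by
  have h1 : Summable fun m : ℕ => (m : ℝ) ^ 1 * (1 / 2 : ℝ) ^ m :=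
    summable_pow_mul_geometric_of_norm_lt_one 1 (by norm_num)
  have h2 : Summable fun m : ℕ => (3 : ℝ) * (1 / 2 : ℝ) ^ m :=
    (summable_geometric_of_lt_one (by norm_num) (by norm_num)).mul_left 3
  refine (h1.add h2).congr fun m => ?_
  ring

lemma S0_pos : 0 < S0 := by
  unfold S0
  exact S0_summable.tsum_pos (fun m => by positivity) 0 (by norm_num)

variable (β : ℕ → ℝ) (K r0 : ℝ)

/-- the nonlinearity -/
def NN (W : X) : X := ∑' m, (β m : ℂ) • pw σ hσ ν hν W m

lemma NN_summable (hr0 : 0 ≤ r0) (hβ : ∀ m, |β m| * r0 ^ m ≤ K * (1 / 2) ^ m)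
    (W : X) (hW : ‖W‖ ≤ r0) :
    Summable fun m => (β m : ℂ) • pw σ hσ ν hν W m := by
  refine Summable.of_norm_bounded (g := fun m => r0 ^ 3 * (K * (1 / 2) ^ m)) ?_ ?_
  · exact ((summable_geometric_of_lt_one (by norm_num) (by norm_num)).mul_left K).mul_left _
  · intro m
    rw [norm_smul, Complex.norm_real, Real.norm_eq_abs]
    calc |β m| * ‖pw σ hσ ν hν W m‖ ≤ |β m| * r0 ^ (m + 3) := by
          gcongr
          exact (pw_norm_le _ _ _ _ _ _).trans (by gcongr)
      _ = r0 ^ 3 * (|β m| * r0 ^ m) := by ring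
      _ ≤ _ := mul_le_mul_of_nonneg_left (hβ m) (by positivity)

lemma NN_diff (hr0 : 0 ≤ r0) (hβ : ∀ m, |β m| * r0 ^ m ≤ K * (1 / 2) ^ m)
    (W Z : X) (r : ℝ) (hr : r ≤ r0) (hW : ‖W‖ ≤ r) (hZ : ‖Z‖ ≤ r) :
    ‖NN σ hσ ν hν β W - NN σ hσ ν hν β Z‖ ≤ K * S0 * r ^ 2 * ‖W - Z‖ := by
  have hrn : 0 ≤ r := (norm_nonneg _).trans hW
  unfold NN
  rw [← (NN_summable σ hσ ν hν β K r0 hr0 hβ W (hW.trans hr)).tsum_sub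
    (NN_summable σ hσ ν hν β K r0 hr0 hβ Z (hZ.trans hr))]
  have hs := S0_summable.hasSum.mul_left (K * r ^ 2 * ‖W - Z‖)
  have : K * S0 * r ^ 2 * ‖W - Z‖ = K * r ^ 2 * ‖W - Z‖ * S0 := by ring
  rw [this]
  refine tsum_of_norm_bounded hs fun m => ?_
  rw [← smul_sub, norm_smul, Complex.norm_real, Real.norm_eq_abs]
  calc |β m| * _ ≤ |β m| * ((m + 3) * r ^ (m + 2) * ‖W - Z‖) := by
        gcongr
        exact pw_diff _ _ _ _ _ _ _ hW hZ _
    _ = (|β m| * r ^ m) * ((m + 3) * r ^ 2 * ‖W - Z‖) := by ring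
    _ ≤ (|β m| * r0 ^ m) * ((m + 3) * r ^ 2 * ‖W - Z‖) := by gcongr
    _ ≤ (K * (1 / 2) ^ m) * ((m + 3) * r ^ 2 * ‖W - Z‖) :=
        mul_le_mul_of_nonneg_right (hβ m) (by positivity)
    _ = _ := by ring

lemma NN_zero : NN σ hσ ν hν β 0 = 0 := by
  unfold NN
  have : ∀ m, (β m : ℂ) • pw σ hσ ν hν 0 m = 0 := by
    intro m
    have h := pw_norm_le σ hσ ν hν 0 m
    rw [norm_zero, zero_pow (by omega)] at h
    rw [norm_le_zero_iff.1 h, smul_zero]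
  simp [this]

lemma ev_NN (hr0 : 0 ≤ r0) (hβ : ∀ m, |β m| * r0 ^ m ≤ K * (1 / 2) ^ m)
    (W : X) (hW : ‖W‖ ≤ r0) (y τ : ℝ) :
    (qB ν hν y) ^ 3 * ev σ hσ y τ (NN σ hσ ν hν β W)
      = ∑' m, (β m : ℂ) * (qB ν hν y * ev σ hσ y τ W) ^ (m + 3) := by
  unfold NN
  rw [ContinuousLinearMap.map_tsum _ (NN_summable σ hσ ν hν β K r0 hr0 hβ W hW), ← tsum_mul_left]
  refine tsum_congr fun m => ?_
  rw [map_smul, ev_pw, smul_eq_mul]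
  ring

lemma Sym.NN {W : X} (h : Sym W) (hs : Summable fun m => (β m : ℂ) • KG.pw σ hσ ν hν W m) :
    Sym (NN σ hσ ν hν β W) := by
  intro n
  have key : ∀ n, (KG.NN σ hσ ν hν β W) n = ∑' m, ((β m : ℂ) • KG.pw σ hσ ν hν W m) n := by
    intro n
    exact ContinuousLinearMap.map_tsum (lp.evalCLM ℂ (fun _ : ℤ => B) 1 n) hs
  rw [key, key, tsum_star]
  refine tsum_congr fun m => ?_
  rw [lp.coeFn_smul, Pi.smul_apply, Pi.smul_apply, h.pw σ hσ ν hν m n]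
  ext y
  simp

end

end KG

namespace KG
lemma f_series (f : ℂ → ℂ) (hf : AssumptionA f) : ∃ β : ℕ → ℝ, ∃ K r0 : ℝ, 0 < r0 ∧ 0 < K ∧
    (∀ m, |β m| * r0 ^ m ≤ K * (1 / 2) ^ m) ∧
    ∀ x : ℝ, |x| ≤ r0 → HasSum (fun m => β m * x ^ (m + 3)) (1 / 3 * x ^ 3 + (f x).re) := by
  obtain ⟨ha, -, -, hO⟩ := hf
  -- factor
  have hfac : ∃ g : ℂ → ℂ, AnalyticAt ℂ g 0 ∧ ∀ᶠ z in 𝓝 (0 : ℂ), f z = (z - 0) ^ 3 • g z := by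
    rw [← natCast_le_analyticOrderAt ha]
    by_contra hlt
    push Not at hlt
    have hne : analyticOrderAt f 0 ≠ ⊤ := ne_top_of_lt hlt
    obtain ⟨d, hd⟩ := ENat.ne_top_iff_exists.1 hne
    rw [← hd] at hlt
    have hd3 : d < 3 := by exact_mod_cast hlt
    obtain ⟨g, hg, hg0, hfg⟩ := (ha.analyticOrderAt_eq_natCast).1 hd.symm
    obtain ⟨C, hC⟩ := hO.bound
    have h1 : ∀ᶠ z in 𝓝[≠] (0 : ℂ), ‖g z‖ ≤ C * ‖z‖ ^ (5 - d) := by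
      filter_upwards [nhdsWithin_le_nhds hC, nhdsWithin_le_nhds hfg, self_mem_nhdsWithin]
        with z h1 h2 h3
      have h3 : 0 < ‖z‖ := norm_pos_iff.2 h3
      rw [h2, sub_zero, smul_eq_mul, norm_mul, norm_pow, norm_pow] at h1
      have e : ‖z‖ ^ 5 = ‖z‖ ^ d * ‖z‖ ^ (5 - d) := by rw [← pow_add]; congr 1; omega
      rw [e] at h1
      have : 0 < ‖z‖ ^ d := by positivity
      nlinarith
    have h2 : Tendsto (fun z : ℂ => C * ‖z‖ ^ (5 - d)) (𝓝[≠] 0) (𝓝 0) := by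
      have : Tendsto (fun z : ℂ => C * ‖z‖ ^ (5 - d)) (𝓝 0) (𝓝 (C * ‖(0 : ℂ)‖ ^ (5 - d))) :=
        Continuous.tendsto (by fun_prop) 0
      rw [norm_zero, zero_pow (by omega), mul_zero] at this
      exact this.mono_left nhdsWithin_le_nhds
    have h3 : Tendsto (fun z => ‖g z‖) (𝓝[≠] 0) (𝓝 ‖g 0‖) :=
      (hg.continuousAt.norm).tendsto.mono_left nhdsWithin_le_nhds
    have := le_of_tendsto_of_tendsto h3 h2 h1
    exact hg0 (norm_le_zero_iff.1 this)
  obtain ⟨g, hg, hfg⟩ := hfac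
  have hh : AnalyticAt ℂ (fun z => 1 / 3 + g z) 0 := analyticAt_const.add hg
  obtain ⟨p, R, hp⟩ := hh
  obtain ⟨ε, hε, hfg⟩ := Metric.eventually_nhds_iff.1 hfg
  -- radius
  obtain ⟨r1, hr1, hr1R⟩ := ENNReal.lt_iff_exists_nnreal_btwn.1 hp.r_pos
  have hr1pos : 0 < r1 := by exact_mod_cast hr1
  obtain ⟨K, hK, hKb⟩ := p.norm_mul_pow_le_of_lt_radius (lt_of_lt_of_le hr1R hp.r_le)
  refine ⟨fun m => (p.coeff m).re, K, min (r1 / 2) (ε / 2), ?_, hK, ?_, ?_⟩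
  · have : (0 : ℝ) < r1 := by exact_mod_cast hr1pos
    positivity
  · intro m
    have h1 : |(p.coeff m).re| ≤ ‖p m‖ :=
      (Complex.abs_re_le_norm _).trans (by rw [p.norm_apply_eq_norm_coef])
    have hmin : 0 ≤ min ((r1 : ℝ) / 2) (ε / 2) := by positivity
    calc |(p.coeff m).re| * (min ((r1 : ℝ) / 2) (ε / 2)) ^ m ≤ ‖p m‖ * ((r1 : ℝ) / 2) ^ m := by
          gcongr
          exact min_le_left _ _
      _ = ‖p m‖ * r1 ^ m * (1 / 2) ^ m := by
          rw [div_pow, one_div, inv_pow]; ring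
      _ ≤ _ := by gcongr; exact hKb m
  · intro x hx
    have hr1' : (0 : ℝ) < r1 := by exact_mod_cast hr1pos
    have hx1 : |x| < r1 := by
      have := hx.trans (min_le_left _ _); linarith
    have hx2 : |x| < ε := by
      have := hx.trans (min_le_right _ _); linarith
    have hmem : (x : ℂ) ∈ Metric.eball (0 : ℂ) R := by
      rw [Metric.mem_eball, edist_zero_right]
      refine lt_trans ?_ hr1R
      rw [← ofReal_norm, Complex.norm_real, Real.norm_eq_abs]
      rw [ENNReal.ofReal_lt_coe_iff (by positivity)]
      exact hx1
    have hs := hp.hasSum hmem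
    have hs2 := hs.mul_left ((x : ℂ) ^ 3)
    have hs3 := Complex.hasSum_re hs2
    have hfx : f x = (x : ℂ) ^ 3 * g x := by
      have := hfg (y := (x : ℂ)) (by rw [dist_zero_right, Complex.norm_real]; exact hx2)
      simpa using this
    have e1 : ((x : ℂ) ^ 3 * (1 / 3 + g (0 + x))).re = 1 / 3 * x ^ 3 + (f x).re := by
      rw [zero_add, mul_add, Complex.add_re, hfx]
      congr 1
      have : (x : ℂ) ^ 3 * (1 / 3) = ((1 / 3 * x ^ 3 : ℝ) : ℂ) := by push_cast; ring
      rw [this, Complex.ofReal_re]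
    rw [e1] at hs3
    convert hs3 using 1
    funext m
    rw [p.apply_eq_pow_smul_coeff, smul_eq_mul]
    have : (x : ℂ) ^ 3 * ((x : ℂ) ^ m * p.coeff m) = ((x ^ (m + 3) : ℝ) : ℂ) * p.coeff m := by
      push_cast; ring
    rw [this, Complex.re_ofReal_mul, mul_comm]
end KG

namespace KG

/-- tail integral -/
def tail (h : ℝ → ℂ) (x : ℝ) : ℂ := (∫ s in Set.Ioi (0 : ℝ), h s) - ∫ s in (0 : ℝ)..x, h s

lemma integral_deriv (h : ℝ → ℂ) (hc : Continuous h) (x : ℝ) :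
    HasDerivAt (fun x => ∫ s in (0 : ℝ)..x, h s) (h x) x :=
  intervalIntegral.integral_hasDerivAt_right (hc.intervalIntegrable _ _)
    (hc.stronglyMeasurableAtFilter _ _) hc.continuousAt

lemma tail_deriv (h : ℝ → ℂ) (hc : Continuous h) (x : ℝ) : HasDerivAt (tail h) (-h x) x := by
  have := (integral_deriv h hc x).const_sub (∫ s in Set.Ioi (0 : ℝ), h s)
  exact this

lemma exp_integrable (D b x : ℝ) (hb : 0 < b) :
    IntegrableOn (fun s => D * Real.exp (-b * s)) (Set.Ioi x) :=
  (integrableOn_exp_mul_Ioi (by linarith) x).const_mul D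

lemma h_integrable (h : ℝ → ℂ) (hc : Continuous h) (D b : ℝ) (hb : 0 < b)
    (hD : ∀ s, 0 ≤ s → ‖h s‖ ≤ D * Real.exp (-b * s)) : IntegrableOn h (Set.Ioi 0) := by
  refine Integrable.mono' (exp_integrable D b 0 hb) hc.aestronglyMeasurable ?_
  refine (ae_restrict_iff' measurableSet_Ioi).2 (ae_of_all _ fun s hs => hD s (le_of_lt hs))

lemma tail_eq (h : ℝ → ℂ) (hi : IntegrableOn h (Set.Ioi 0)) (x : ℝ) (hx : 0 ≤ x) :
    tail h x = ∫ s in Set.Ioi x, h s := by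
  unfold tail
  have := intervalIntegral.integral_interval_add_Ioi (a := 0) (b := x) (f := h) hi
    (hi.mono_set (Set.Ioi_subset_Ioi hx))
  rw [← this]; ring

lemma tail_bound (h : ℝ → ℂ) (hi : IntegrableOn h (Set.Ioi 0)) (x : ℝ) (hx : 0 ≤ x)
    (D b : ℝ) (hb : 0 < b) (hD : ∀ s, x ≤ s → ‖h s‖ ≤ D * Real.exp (-b * s)) :
    ‖tail h x‖ ≤ D * Real.exp (-b * x) / b := by
  rw [tail_eq h hi x hx]
  calc ‖∫ s in Set.Ioi x, h s‖ ≤ ∫ s in Set.Ioi x, D * Real.exp (-b * s) := by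
        refine norm_integral_le_of_norm_le (exp_integrable D b x hb) ?_
        exact (ae_restrict_iff' measurableSet_Ioi).2 (ae_of_all _ fun s hs => hD s (le_of_lt hs))
    _ = _ := by
        rw [integral_const_mul, integral_exp_mul_Ioi (by linarith)]
        field_simp

lemma int_bound (h : ℝ → ℂ) (x : ℝ) (hx : 0 ≤ x) (D b : ℝ) (hb : 0 < b) (hD0 : 0 ≤ D)
    (hD : ∀ s, 0 ≤ s → s ≤ x → ‖h s‖ ≤ D * Real.exp (-b * s)) :
    ‖∫ s in (0 : ℝ)..x, h s‖ ≤ D / b := by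
  rw [intervalIntegral.integral_of_le hx]
  calc ‖∫ s in Set.Ioc 0 x, h s‖ ≤ ∫ s in Set.Ioc 0 x, D * Real.exp (-b * s) := by
        refine norm_integral_le_of_norm_le
          ((exp_integrable D b 0 hb).mono_set Set.Ioc_subset_Ioi_self) ?_
        exact (ae_restrict_iff' measurableSet_Ioc).2
          (ae_of_all _ fun s hs => hD s (le_of_lt hs.1) hs.2)
    _ ≤ ∫ s in Set.Ioi 0, D * Real.exp (-b * s) := by
        refine setIntegral_mono_set (exp_integrable D b 0 hb) ?_
          (Set.Ioc_subset_Ioi_self.eventuallyLE)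
        exact ae_of_all _ fun s => by positivity
    _ = _ := by
        rw [integral_const_mul, integral_exp_mul_Ioi (by linarith)]
        simp
        field_simp

lemma tail_sub (h k : ℝ → ℂ) (hc : Continuous h) (kc : Continuous k)
    (hi : IntegrableOn h (Set.Ioi 0)) (ki : IntegrableOn k (Set.Ioi 0)) (x : ℝ) :
    tail (fun s => h s - k s) x = tail h x - tail k x := by
  unfold tail
  rw [integral_sub hi ki, intervalIntegral.integral_sub (hc.intervalIntegrable _ _)
    (kc.intervalIntegrable _ _)]
  ring

lemma tail_mul (h : ℝ → ℂ) (c : ℂ) (x : ℝ) : tail (fun s => c * h s) x = c * tail h x := by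
  unfold tail
  rw [integral_const_mul, intervalIntegral.integral_const_mul]; ring

lemma int_conj (h : ℝ → ℂ) (x : ℝ) : ∫ s in (0 : ℝ)..x, (starRingEnd ℂ) (h s)
    = (starRingEnd ℂ) (∫ s in (0 : ℝ)..x, h s) := by
  rw [intervalIntegral, intervalIntegral, integral_conj, integral_conj, map_sub]

lemma tail_conj (h : ℝ → ℂ) (x : ℝ) :
    tail (fun s => (starRingEnd ℂ) (h s)) x = (starRingEnd ℂ) (tail h x) := by
  unfold tail
  rw [integral_conj, int_conj, map_sub]

/-- admissible sources -/
def GG (ν : ℝ) (G : ℝ → ℂ) : Prop :=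
  Continuous G ∧ ∃ C, ∀ s, 0 ≤ s → ‖G s‖ ≤ C * Real.exp (-(3 * ν) * s)

/-- the per-mode solution operator -/
structure Mode (κ ν : ℝ) where
  V : (ℝ → ℂ) → ℝ → ℂ
  V' : (ℝ → ℂ) → ℝ → ℂ
  d1 : ∀ G, GG ν G → ∀ x, HasDerivAt (V G) (V' G x) x
  d2 : ∀ G, GG ν G → ∀ x, HasDerivAt (V' G) (κ * V G x - G x) x
  sub1 : ∀ G H, GG ν G → GG ν H → ∀ x, V (fun s => G s - H s) x = V G x - V H x
  sub2 : ∀ G H, GG ν G → GG ν H → ∀ x, V' (fun s => G s - H s) x = V' G x - V' H x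
  b1 : ∀ G, GG ν G → ∀ C, (∀ s, 0 ≤ s → ‖G s‖ ≤ C * Real.exp (-(3 * ν) * s)) → ∀ x, 0 ≤ x →
    ‖V G x‖ ≤ C / ν ^ 2 * Real.exp (-ν * x)
  b2 : ∀ G, GG ν G → ∀ C, (∀ s, 0 ≤ s → ‖G s‖ ≤ C * Real.exp (-(3 * ν) * s)) → ∀ x, 0 ≤ x →
    ‖V' G x‖ ≤ C / ν * Real.exp (-ν * x)
  cj : ∀ G, ∀ x, V (fun s => (starRingEnd ℂ) (G s)) x = (starRingEnd ℂ) (V G x)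

lemma center_mode (κ ν : ℝ) (hν : 0 < ν) (φ ψ : ℝ → ℝ) (dφ : ∀ x, HasDerivAt φ (κ * ψ x) x)
    (dψ : ∀ x, HasDerivAt ψ (φ x) x) (hW : ∀ x, φ x ^ 2 - κ * ψ x ^ 2 = 1)
    (h1 : ∀ x s, ψ x * φ s - φ x * ψ s = -ψ (s - x))
    (h2 : ∀ x s, φ x * φ s - κ * ψ x * ψ s = φ (s - x))
    (bφ : ∀ x, |φ x| ≤ 1) (bψ : ∀ x, |ψ x| ≤ |x|) : Nonempty (Mode κ ν) := by
  have cφ : Continuous φ := continuous_iff_continuousAt.2 fun x => (dφ x).continuousAt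
  have cψ : Continuous ψ := continuous_iff_continuousAt.2 fun x => (dψ x).continuousAt
  have texp : ∀ t : ℝ, 0 ≤ t → t ≤ Real.exp (ν * t) / ν := by
    intro t ht
    rw [le_div_iff₀ hν]
    have := Real.add_one_le_exp (ν * t)
    linarith
  have cG1 : ∀ G, GG ν G → Continuous fun s => (φ s : ℂ) * G s := fun G hG =>
    (Complex.continuous_ofReal.comp cφ).mul hG.1
  have cG2 : ∀ G, GG ν G → Continuous fun s => (ψ s : ℂ) * G s := fun G hG =>
    (Complex.continuous_ofReal.comp cψ).mul hG.1
  have i1 : ∀ G, GG ν G → IntegrableOn (fun s => (φ s : ℂ) * G s) (Set.Ioi 0) := by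
    intro G hG
    obtain ⟨C, hC⟩ := hG.2
    refine h_integrable _ (cG1 G hG) C (3 * ν) (by positivity) fun s hs => ?_
    rw [norm_mul, Complex.norm_real, Real.norm_eq_abs]
    calc |φ s| * ‖G s‖ ≤ 1 * ‖G s‖ := by gcongr; exact bφ s
      _ ≤ _ := by rw [one_mul]; exact hC s hs
  have i2 : ∀ G, GG ν G → IntegrableOn (fun s => (ψ s : ℂ) * G s) (Set.Ioi 0) := by
    intro G hG
    obtain ⟨C, hC⟩ := hG.2
    refine h_integrable _ (cG2 G hG) (C / ν) (2 * ν) (by positivity) fun s hs => ?_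
    rw [norm_mul, Complex.norm_real, Real.norm_eq_abs]
    have h3 : |ψ s| ≤ Real.exp (ν * s) / ν := (bψ s).trans (by rw [abs_of_nonneg hs]; exact texp s hs)
    calc |ψ s| * ‖G s‖ ≤ (Real.exp (ν * s) / ν) * (C * Real.exp (-(3 * ν) * s)) :=
          mul_le_mul h3 (hC s hs) (norm_nonneg _) (by positivity)
      _ = C / ν * (Real.exp (ν * s) * Real.exp (-(3 * ν) * s)) := by ring
      _ = _ := by rw [← Real.exp_add]; congr 2; ring
  let P : (ℝ → ℂ) → ℝ → ℂ := fun G x => - tail (fun s => (ψ s : ℂ) * G s) x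
  let Q : (ℝ → ℂ) → ℝ → ℂ := fun G x => tail (fun s => (φ s : ℂ) * G s) x
  have dP : ∀ G, GG ν G → ∀ x, HasDerivAt (P G) ((ψ x : ℂ) * G x) x := by
    intro G hG x
    have := (tail_deriv _ (cG2 G hG) x).neg
    rw [neg_neg] at this
    exact this
  have dQ : ∀ G, GG ν G → ∀ x, HasDerivAt (Q G) (-((φ x : ℂ) * G x)) x :=
    fun G hG x => tail_deriv _ (cG1 G hG) x
  have kern : ∀ G, GG ν G → ∀ c d : ℂ, ∀ x, d * P G x + c * Q G x
      = tail (fun s => c * ((φ s : ℂ) * G s) - d * ((ψ s : ℂ) * G s)) x := by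
    intro G hG c d x
    rw [tail_sub _ _ ((cG1 G hG).const_mul c) ((cG2 G hG).const_mul d) ((i1 G hG).const_mul c)
      ((i2 G hG).const_mul d), tail_mul, tail_mul]
    simp only [P, Q]
    ring
  have cφ' : ∀ x, HasDerivAt (fun x => (φ x : ℂ)) ((κ * ψ x : ℝ) : ℂ) x := fun x => (dφ x).ofReal_comp
  have cψ' : ∀ x, HasDerivAt (fun x => (ψ x : ℂ)) ((φ x : ℝ) : ℂ) x := fun x => (dψ x).ofReal_comp
  have Psub : ∀ G H, GG ν G → GG ν H → ∀ x, P (fun s => G s - H s) x = P G x - P H x := by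
    intro G H hG hH x
    have := tail_sub _ _ (cG2 G hG) (cG2 H hH) (i2 G hG) (i2 H hH) x
    simp only [P, mul_sub]
    rw [this]; ring
  have Qsub : ∀ G H, GG ν G → GG ν H → ∀ x, Q (fun s => G s - H s) x = Q G x - Q H x := by
    intro G H hG hH x
    have := tail_sub _ _ (cG1 G hG) (cG1 H hH) (i1 G hG) (i1 H hH) x
    simp only [Q, mul_sub]
    rw [this]
  refine ⟨{ V := fun G x => (φ x : ℂ) * P G x + (ψ x : ℂ) * Q G x
            V' := fun G x => ((κ * ψ x : ℝ) : ℂ) * P G x + ((φ x : ℝ) : ℂ) * Q G x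
            d1 := ?_, d2 := ?_, sub1 := ?_, sub2 := ?_, b1 := ?_, b2 := ?_, cj := ?_ }⟩
  · intro G hG x
    have := ((cφ' x).mul (dP G hG x)).add ((cψ' x).mul (dQ G hG x))
    refine this.congr_deriv ?_
    ring
  · intro G hG x
    have h3 : HasDerivAt (fun x => ((κ * ψ x : ℝ) : ℂ)) ((κ * φ x : ℝ) : ℂ) x :=
      ((dψ x).const_mul κ).ofReal_comp
    have := (h3.mul (dP G hG x)).add ((cφ' x).mul (dQ G hG x))
    refine this.congr_deriv ?_
    have hw : (φ x : ℂ) ^ 2 - κ * (ψ x : ℂ) ^ 2 = 1 := by exact_mod_cast hW x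
    push_cast
    linear_combination (-G x) * hw
  · intro G H hG hH x
    simp only [Psub G H hG hH, Qsub G H hG hH]; ring
  · intro G H hG hH x
    simp only [Psub G H hG hH, Qsub G H hG hH]; ring
  · intro G hG C hC x hx
    have hC0 : 0 ≤ C := by
      have := (norm_nonneg _).trans (hC 0 le_rfl)
      simpa using this
    change ‖(φ x : ℂ) * P G x + (ψ x : ℂ) * Q G x‖ ≤ _
    rw [kern G hG]
    have hb := tail_bound (fun s => (ψ x : ℂ) * ((φ s : ℂ) * G s) - (φ x : ℂ) * ((ψ s : ℂ) * G s))
      (((i1 G hG).const_mul _).sub ((i2 G hG).const_mul _)) x hx (C / ν * Real.exp (-ν * x)) (2 * ν)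
      (by positivity) (by
        intro s hs
        have e : (ψ x : ℂ) * ((φ s : ℂ) * G s) - (φ x : ℂ) * ((ψ s : ℂ) * G s)
            = ((ψ x * φ s - φ x * ψ s : ℝ) : ℂ) * G s := by push_cast; ring
        rw [e, h1, norm_mul, Complex.norm_real, Real.norm_eq_abs, abs_neg]
        have h3 : |ψ (s - x)| ≤ Real.exp (ν * (s - x)) / ν :=
          (bψ _).trans (by rw [abs_of_nonneg (by linarith)]; exact texp _ (by linarith))
        calc _ ≤ (Real.exp (ν * (s - x)) / ν) * (C * Real.exp (-(3 * ν) * s)) :=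
              mul_le_mul h3 (hC s (hx.trans hs)) (norm_nonneg _) (by positivity)
          _ = C / ν * (Real.exp (ν * (s - x)) * Real.exp (-(3 * ν) * s)) := by ring
          _ = C / ν * (Real.exp (-ν * x) * Real.exp (-(2 * ν) * s)) := by
              rw [← Real.exp_add, ← Real.exp_add]; congr 2; ring
          _ = _ := by ring)
    refine hb.trans ?_
    have h4 : Real.exp (-(2 * ν) * x) ≤ 1 := by
      rw [Real.exp_le_one_iff]; nlinarith
    calc C / ν * Real.exp (-ν * x) * Real.exp (-(2 * ν) * x) / (2 * ν)
        ≤ C / ν * Real.exp (-ν * x) * 1 / ν := by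
          gcongr
          linarith
      _ = _ := by field_simp
  · intro G hG C hC x hx
    have hC0 : 0 ≤ C := by
      have := (norm_nonneg _).trans (hC 0 le_rfl)
      simpa using this
    change ‖((κ * ψ x : ℝ) : ℂ) * P G x + ((φ x : ℝ) : ℂ) * Q G x‖ ≤ _
    rw [kern G hG]
    have hb := tail_bound (fun s => (φ x : ℂ) * ((φ s : ℂ) * G s)
        - ((κ * ψ x : ℝ) : ℂ) * ((ψ s : ℂ) * G s))
      (((i1 G hG).const_mul _).sub ((i2 G hG).const_mul _)) x hx C (3 * ν)
      (by positivity) (by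
        intro s hs
        have e : (φ x : ℂ) * ((φ s : ℂ) * G s) - ((κ * ψ x : ℝ) : ℂ) * ((ψ s : ℂ) * G s)
            = ((φ x * φ s - κ * ψ x * ψ s : ℝ) : ℂ) * G s := by push_cast; ring
        rw [e, h2, norm_mul, Complex.norm_real, Real.norm_eq_abs]
        calc _ ≤ 1 * ‖G s‖ := by gcongr; exact bφ _
          _ ≤ _ := by rw [one_mul]; exact hC s (hx.trans hs))
    refine hb.trans ?_
    have h4 : Real.exp (-(3 * ν) * x) ≤ Real.exp (-ν * x) := Real.exp_le_exp.2 (by nlinarith)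
    calc C * Real.exp (-(3 * ν) * x) / (3 * ν)
        ≤ C * Real.exp (-ν * x) / ν := by
          gcongr
          linarith
      _ = _ := by field_simp
  · intro G x
    have e1 := tail_conj (fun s => (ψ s : ℂ) * G s) x
    have e2 := tail_conj (fun s => (φ s : ℂ) * G s) x
    simp only [map_mul, Complex.conj_ofReal] at e1 e2
    simp only [P, Q, map_add, map_mul, map_neg, Complex.conj_ofReal, e1, e2]

lemma center_mode' (κ ν : ℝ) (hν : 0 < ν) (hκ : κ ≤ 0) : Nonempty (Mode κ ν) := by
  rcases eq_or_lt_of_le hκ with h0 | h0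
  · subst h0
    refine center_mode 0 ν hν (fun _ => 1) (fun x => x) ?_ ?_ ?_ ?_ ?_ ?_ ?_
    · intro x; simpa using hasDerivAt_const x (1 : ℝ)
    · intro x; exact hasDerivAt_id x
    · intro x; simp
    · intro x s; ring
    · intro x s; ring
    · intro x; simp
    · intro x; exact le_rfl
  · set l := Real.sqrt (-κ) with hl
    have hl0 : 0 < l := Real.sqrt_pos.2 (by linarith)
    have hl2 : κ = -l ^ 2 := by rw [hl, Real.sq_sqrt (by linarith)]; ring
    have hln : l ≠ 0 := hl0.ne'
    refine center_mode κ ν hν (fun x => Real.cos (l * x)) (fun x => Real.sin (l * x) / l)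
      ?_ ?_ ?_ ?_ ?_ ?_ ?_
    · intro x
      have := ((hasDerivAt_id x).const_mul l).cos
      refine this.congr_deriv ?_
      rw [hl2]; simp; field_simp
    · intro x
      have := ((hasDerivAt_id x).const_mul l).sin.div_const l
      refine this.congr_deriv ?_
      simp; field_simp
    · intro x
      rw [hl2]
      have := Real.sin_sq_add_cos_sq (l * x)
      field_simp
      linarith
    · intro x s
      have := Real.sin_sub (l * s) (l * x)
      rw [mul_sub, this]; field_simp; ring
    · intro x s
      have := Real.cos_sub (l * s) (l * x)
      rw [mul_sub, this, hl2]; field_simp; ring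
    · intro x; exact Real.abs_cos_le_one _
    · intro x
      rw [abs_div, abs_of_pos hl0, div_le_iff₀ hl0]
      have := Real.abs_sin_le_abs (x := l * x)
      rw [abs_mul, abs_of_pos hl0] at this
      linarith

end KG

namespace KG

lemma hyper_mode (κ ν : ℝ) (hν : 0 < ν) (hκ : ν ^ 2 ≤ κ) : Nonempty (Mode κ ν) := by
  set μ := Real.sqrt κ with hμ
  have hμν : ν ≤ μ := Real.le_sqrt_of_sq_le hκ
  have hμ0 : 0 < μ := hν.trans_le hμν
  have hμ2 : κ = μ ^ 2 := by rw [hμ, Real.sq_sqrt ((sq_nonneg ν).trans hκ)]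
  let φ : ℝ → ℝ := fun x => Real.exp (-μ * x)
  let ψ : ℝ → ℝ := fun x => Real.exp (μ * x) / (2 * μ)
  have dφ : ∀ x, HasDerivAt φ (-μ * φ x) x := by
    intro x
    have := ((hasDerivAt_id x).const_mul (-μ)).exp
    refine this.congr_deriv ?_
    simp [φ]; ring
  have dψ : ∀ x, HasDerivAt ψ (μ * ψ x) x := by
    intro x
    have := ((hasDerivAt_id x).const_mul μ).exp.div_const (2 * μ)
    refine this.congr_deriv ?_
    simp [ψ]; ring
  have hφψ : ∀ x, 2 * μ * (φ x * ψ x) = 1 := by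
    intro x
    have : φ x * ψ x = (Real.exp (-μ * x) * Real.exp (μ * x)) / (2 * μ) := by simp only [φ, ψ]; ring
    rw [this, ← Real.exp_add]
    have : -μ * x + μ * x = 0 := by ring
    rw [this, Real.exp_zero]; field_simp
  have φ0 : ∀ x, 0 < φ x := fun x => Real.exp_pos _
  have ψ0 : ∀ x, 0 < ψ x := fun x => by simp only [ψ]; positivity
  have cφ : Continuous φ := continuous_iff_continuousAt.2 fun x => (dφ x).continuousAt
  have cψ : Continuous ψ := continuous_iff_continuousAt.2 fun x => (dψ x).continuousAt
  have cG1 : ∀ G, GG ν G → Continuous fun s => (φ s : ℂ) * G s := fun G hG =>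
    (Complex.continuous_ofReal.comp cφ).mul hG.1
  have cG2 : ∀ G, GG ν G → Continuous fun s => (ψ s : ℂ) * G s := fun G hG =>
    (Complex.continuous_ofReal.comp cψ).mul hG.1
  have bd : ∀ (G : ℝ → ℂ) (C : ℝ), (∀ s, 0 ≤ s → ‖G s‖ ≤ C * Real.exp (-(3 * ν) * s)) →
      ∀ s, 0 ≤ s → ‖(φ s : ℂ) * G s‖ ≤ C * Real.exp (-(μ + 3 * ν) * s) := by
    intro G C hC s hs
    rw [norm_mul, Complex.norm_real, Real.norm_eq_abs, abs_of_pos (φ0 s)]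
    calc φ s * ‖G s‖ ≤ φ s * (C * Real.exp (-(3 * ν) * s)) := by
          gcongr
          exact hC s hs
      _ = C * (Real.exp (-μ * s) * Real.exp (-(3 * ν) * s)) := by simp only [φ]; ring
      _ = _ := by rw [← Real.exp_add]; congr 2; ring
  have i1 : ∀ G, GG ν G → IntegrableOn (fun s => (φ s : ℂ) * G s) (Set.Ioi 0) := by
    intro G hG
    obtain ⟨C, hC⟩ := hG.2
    exact h_integrable _ (cG1 G hG) C (μ + 3 * ν) (by positivity) (bd G C hC)
  let P : (ℝ → ℂ) → ℝ → ℂ := fun G x => ∫ s in (0 : ℝ)..x, (ψ s : ℂ) * G s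
  let Q : (ℝ → ℂ) → ℝ → ℂ := fun G x => tail (fun s => (φ s : ℂ) * G s) x
  have dP : ∀ G, GG ν G → ∀ x, HasDerivAt (P G) ((ψ x : ℂ) * G x) x :=
    fun G hG x => integral_deriv _ (cG2 G hG) x
  have dQ : ∀ G, GG ν G → ∀ x, HasDerivAt (Q G) (-((φ x : ℂ) * G x)) x :=
    fun G hG x => tail_deriv _ (cG1 G hG) x
  have cφ' : ∀ x, HasDerivAt (fun x => (φ x : ℂ)) ((-μ * φ x : ℝ) : ℂ) x :=
    fun x => (dφ x).ofReal_comp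
  have cψ' : ∀ x, HasDerivAt (fun x => (ψ x : ℂ)) ((μ * ψ x : ℝ) : ℂ) x :=
    fun x => (dψ x).ofReal_comp
  have Psub : ∀ G H, GG ν G → GG ν H → ∀ x, P (fun s => G s - H s) x = P G x - P H x := by
    intro G H hG hH x
    simp only [P, mul_sub]
    exact intervalIntegral.integral_sub ((cG2 G hG).intervalIntegrable _ _)
      ((cG2 H hH).intervalIntegrable _ _)
  have Qsub : ∀ G H, GG ν G → GG ν H → ∀ x, Q (fun s => G s - H s) x = Q G x - Q H x := by
    intro G H hG hH x
    have := tail_sub _ _ (cG1 G hG) (cG1 H hH) (i1 G hG) (i1 H hH) x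
    simp only [Q, mul_sub]
    rw [this]
  -- the two basic bounds
  have bP : ∀ (G : ℝ → ℂ) (C : ℝ), 0 ≤ C →
      (∀ s, 0 ≤ s → ‖G s‖ ≤ C * Real.exp (-(3 * ν) * s)) → ∀ x, 0 ≤ x →
      ‖(φ x : ℂ) * P G x‖ ≤ C / (4 * μ * ν) * Real.exp (-ν * x) := by
    intro G C hC0 hC x hx
    have h := int_bound (fun s => (ψ s : ℂ) * G s) x hx (C / (2 * μ) * Real.exp ((μ - ν) * x))
      (2 * ν) (by positivity) (by positivity) (by
        intro s hs hsx
        rw [norm_mul, Complex.norm_real, Real.norm_eq_abs, abs_of_pos (ψ0 s)]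
        calc ψ s * ‖G s‖ ≤ ψ s * (C * Real.exp (-(3 * ν) * s)) := by
              gcongr
              exact hC s hs
          _ = C / (2 * μ) * (Real.exp (μ * s) * Real.exp (-(3 * ν) * s)) := by simp only [ψ]; ring
          _ ≤ C / (2 * μ) * (Real.exp ((μ - ν) * x) * Real.exp (-(2 * ν) * s)) := by
              rw [← Real.exp_add, ← Real.exp_add]
              refine mul_le_mul_of_nonneg_left (Real.exp_le_exp.2 ?_) (by positivity)
              nlinarith [mul_nonneg (sub_nonneg.2 hμν) (sub_nonneg.2 hsx)]
          _ = _ := by ring)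
    rw [norm_mul, Complex.norm_real, Real.norm_eq_abs, abs_of_pos (φ0 x)]
    calc φ x * ‖P G x‖ ≤ φ x * (C / (2 * μ) * Real.exp ((μ - ν) * x) / (2 * ν)) := by
          gcongr
      _ = C / (4 * μ * ν) * (Real.exp (-μ * x) * Real.exp ((μ - ν) * x)) := by
          simp only [φ]; field_simp; ring
      _ = _ := by rw [← Real.exp_add]; congr 2; ring
  have bQ : ∀ (G : ℝ → ℂ) (C : ℝ), GG ν G → 0 ≤ C →
      (∀ s, 0 ≤ s → ‖G s‖ ≤ C * Real.exp (-(3 * ν) * s)) → ∀ x, 0 ≤ x →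
      ‖(ψ x : ℂ) * Q G x‖ ≤ C / (4 * μ * ν) * Real.exp (-ν * x) := by
    intro G C hG hC0 hC x hx
    have h := tail_bound (fun s => (φ s : ℂ) * G s) (i1 G hG) x hx C (μ + 3 * ν) (by positivity)
      (fun s hs => bd G C hC s (hx.trans hs))
    rw [norm_mul, Complex.norm_real, Real.norm_eq_abs, abs_of_pos (ψ0 x)]
    calc ψ x * ‖Q G x‖ ≤ ψ x * (C * Real.exp (-(μ + 3 * ν) * x) / (μ + 3 * ν)) := by
          gcongr
      _ = C / (2 * μ * (μ + 3 * ν)) * (Real.exp (μ * x) * Real.exp (-(μ + 3 * ν) * x)) := by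
          simp only [ψ]; field_simp
      _ ≤ C / (4 * μ * ν) * Real.exp (-ν * x) := by
          rw [← Real.exp_add]
          gcongr ?_ * ?_
          · gcongr C / ?_
            nlinarith
          · gcongr
            nlinarith
  refine ⟨{ V := fun G x => (φ x : ℂ) * P G x + (ψ x : ℂ) * Q G x
            V' := fun G x => ((-μ * φ x : ℝ) : ℂ) * P G x + ((μ * ψ x : ℝ) : ℂ) * Q G x
            d1 := ?_, d2 := ?_, sub1 := ?_, sub2 := ?_, b1 := ?_, b2 := ?_, cj := ?_ }⟩
  · intro G hG x
    have := ((cφ' x).mul (dP G hG x)).add ((cψ' x).mul (dQ G hG x))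
    refine this.congr_deriv ?_
    ring
  · intro G hG x
    have h3 : HasDerivAt (fun x => ((-μ * φ x : ℝ) : ℂ)) ((-μ * (-μ * φ x) : ℝ) : ℂ) x :=
      ((dφ x).const_mul (-μ)).ofReal_comp
    have h4 : HasDerivAt (fun x => ((μ * ψ x : ℝ) : ℂ)) ((μ * (μ * ψ x) : ℝ) : ℂ) x :=
      ((dψ x).const_mul μ).ofReal_comp
    have := (h3.mul (dP G hG x)).add (h4.mul (dQ G hG x))
    refine this.congr_deriv ?_
    have hw : 2 * (μ : ℂ) * ((φ x : ℂ) * (ψ x : ℂ)) = 1 := by exact_mod_cast hφψ x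
    rw [hμ2]
    push_cast
    linear_combination (-G x) * hw
  · intro G H hG hH x
    simp only [Psub G H hG hH, Qsub G H hG hH]; ring
  · intro G H hG hH x
    simp only [Psub G H hG hH, Qsub G H hG hH]; ring
  · intro G hG C hC x hx
    have hC0 : 0 ≤ C := by
      have := (norm_nonneg _).trans (hC 0 le_rfl)
      simpa using this
    calc ‖(φ x : ℂ) * P G x + (ψ x : ℂ) * Q G x‖
        ≤ C / (4 * μ * ν) * Real.exp (-ν * x) + C / (4 * μ * ν) * Real.exp (-ν * x) :=
          (norm_add_le _ _).trans (add_le_add (bP G C hC0 hC x hx) (bQ G C hG hC0 hC x hx))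
      _ = C / (2 * μ * ν) * Real.exp (-ν * x) := by field_simp; ring
      _ ≤ _ := by
        gcongr ?_ * ?_
        gcongr C / ?_
        nlinarith
  · intro G hG C hC x hx
    have hC0 : 0 ≤ C := by
      have := (norm_nonneg _).trans (hC 0 le_rfl)
      simpa using this
    have e : ((-μ * φ x : ℝ) : ℂ) * P G x + ((μ * ψ x : ℝ) : ℂ) * Q G x
        = (μ : ℂ) * ((ψ x : ℂ) * Q G x - (φ x : ℂ) * P G x) := by push_cast; ring
    change ‖((-μ * φ x : ℝ) : ℂ) * P G x + ((μ * ψ x : ℝ) : ℂ) * Q G x‖ ≤ _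
    rw [e, norm_mul, Complex.norm_real, Real.norm_eq_abs, abs_of_pos hμ0]
    calc μ * ‖(ψ x : ℂ) * Q G x - (φ x : ℂ) * P G x‖
        ≤ μ * (C / (4 * μ * ν) * Real.exp (-ν * x) + C / (4 * μ * ν) * Real.exp (-ν * x)) := by
          gcongr
          exact (norm_sub_le _ _).trans (add_le_add (bQ G C hG hC0 hC x hx) (bP G C hC0 hC x hx))
      _ = C / (2 * ν) * Real.exp (-ν * x) := by field_simp; ring
      _ ≤ _ := by
        gcongr ?_ * ?_
        gcongr C / ?_
        linarith
  · intro G x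
    have e1 := int_conj (fun s => (ψ s : ℂ) * G s) x
    have e2 := tail_conj (fun s => (φ s : ℂ) * G s) x
    simp only [map_mul, Complex.conj_ofReal] at e1 e2
    simp only [P, Q, map_add, map_mul, Complex.conj_ofReal, e1, e2]

/-- the per-mode solution operator, chosen -/
def theMode (κ ν : ℝ) (hν : 0 < ν) (hκ : ν ^ 2 ≤ κ ∨ κ ≤ 0) : Mode κ ν :=
  Classical.choice (hκ.elim (hyper_mode κ ν hν) (center_mode' κ ν hν))

end KG

namespace KG

/-- unscaled forcing -/
def gG (ν : ℝ) (g : B) (s : ℝ) : ℂ := ((Real.exp (-(3 * ν) * s) : ℝ) : ℂ) * g s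

lemma gG_cont (ν : ℝ) (g : B) : Continuous (gG ν g) := by
  have := g.continuous
  unfold gG
  fun_prop

lemma gG_bound (ν : ℝ) (g : B) (s : ℝ) : ‖gG ν g s‖ ≤ ‖g‖ * Real.exp (-(3 * ν) * s) := by
  unfold gG
  rw [norm_mul, Complex.norm_real, Real.norm_of_nonneg (Real.exp_pos _).le, mul_comm]
  gcongr
  exact g.norm_coe_le_norm s

lemma gG_GG (ν : ℝ) (g : B) : GG ν (gG ν g) := ⟨gG_cont ν g, ‖g‖, fun s _ => gG_bound ν g s⟩

lemma gG_sub (ν : ℝ) (g h : B) : gG ν (g - h) = fun s => gG ν g s - gG ν h s := by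
  funext s
  simp only [gG, BoundedContinuousFunction.coe_sub, Pi.sub_apply]
  ring

lemma gG_star (ν : ℝ) (g : B) : gG ν (star g) = fun s => (starRingEnd ℂ) (gG ν g s) := by
  funext s
  simp only [gG, map_mul, Complex.conj_ofReal]
  rfl

section
variable {κ ν : ℝ} (hν : 0 < ν) (md : Mode κ ν)

lemma V_cont (g : B) : Continuous (md.V (gG ν g)) :=
  continuous_iff_continuousAt.2 fun x => (md.d1 _ (gG_GG ν g) x).continuousAt

/-- one component of the solution operator -/
def TB (g : B) : B :=
  BoundedContinuousFunction.ofNormedAddCommGroup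
    (fun y => ((Real.exp (ν * max y 0) : ℝ) : ℂ) * md.V (gG ν g) (max y 0))
    (by have := V_cont md g; fun_prop) (‖g‖ / ν ^ 2) (by
      intro y
      have h := md.b1 _ (gG_GG ν g) ‖g‖ (fun s _ => gG_bound ν g s) (max y 0) (le_max_right _ _)
      rw [norm_mul, Complex.norm_real, Real.norm_of_nonneg (Real.exp_pos _).le]
      calc _ ≤ Real.exp (ν * max y 0) * (‖g‖ / ν ^ 2 * Real.exp (-ν * max y 0)) := by gcongr
        _ = ‖g‖ / ν ^ 2 * (Real.exp (ν * max y 0) * Real.exp (-ν * max y 0)) := by ring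
        _ = _ := by rw [← Real.exp_add]; simp)

lemma TB_apply (g : B) (y : ℝ) :
    TB md g y = ((Real.exp (ν * max y 0) : ℝ) : ℂ) * md.V (gG ν g) (max y 0) := rfl

lemma TB_norm (g : B) : ‖TB md g‖ ≤ ‖g‖ / ν ^ 2 :=
  BoundedContinuousFunction.norm_ofNormedAddCommGroup_le _ (by positivity) _

lemma TB_sub (g h : B) : TB md (g - h) = TB md g - TB md h := by
  ext y
  rw [BoundedContinuousFunction.coe_sub, Pi.sub_apply]
  simp only [TB_apply, gG_sub, md.sub1 _ _ (gG_GG ν g) (gG_GG ν h)]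
  ring

lemma TB_star (g : B) : TB md (star g) = star (TB md g) := by
  ext y
  change _ = (starRingEnd ℂ) (TB md g y)
  simp only [TB_apply, gG_star, md.cj, map_mul, Complex.conj_ofReal]

end

section
variable {κ : ℤ → ℝ} {ν : ℝ} (md : ∀ n, Mode (κ n) ν)

/-- the solution operator -/
def TX (g : X) : X := mkX (fun n => TB (md n) (g n))
  (Summable.of_nonneg_of_le (fun _ => norm_nonneg _) (fun n => TB_norm (md n) (g n))
    ((X_summable g).div_const _))

lemma TX_apply (g : X) (n : ℤ) : TX md g n = TB (md n) (g n) := rfl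

lemma TX_norm (g : X) : ‖TX md g‖ ≤ ‖g‖ / ν ^ 2 :=
  X_norm_le _ _ _ ((X_hasSum g).div_const _) fun n => TB_norm (md n) (g n)

lemma TX_sub (g h : X) : TX md (g - h) = TX md g - TX md h := by
  apply lp.ext
  funext n
  exact TB_sub (md n) (g n) (h n)

lemma TX_Sym (hm : ∀ n G x, (md (-n)).V G x = (md n).V G x) (g : X) (hg : Sym g) :
    Sym (TX md g) := by
  intro n
  rw [TX_apply, TX_apply, hg n, ← TB_star]
  ext y
  simp only [TB_apply, hm]

end

section
variable (k : ℕ) (E θ : ℤ → ℝ) (hθ : ∀ n, 0 ≤ θ n)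

/-- the linear part in the sequence space -/
def Lx (a : ℤ → ℂ) : X :=
  mkX (fun n => if n ∈ Finset.Icc (-(k : ℤ)) (k : ℤ) then ((E n : ℂ) * a n) • qB (θ n) (hθ n) else 0)
    (summable_of_ne_finset_zero (s := Finset.Icc (-(k : ℤ)) (k : ℤ)) (by
      intro n hn
      rw [if_neg hn, norm_zero]))

lemma Lx_apply (a : ℤ → ℂ) (n : ℤ) : Lx k E θ hθ a n =
    if n ∈ Finset.Icc (-(k : ℤ)) (k : ℤ) then ((E n : ℂ) * a n) • qB (θ n) (hθ n) else 0 := rfl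

lemma Lx_sub (a b : ℤ → ℂ) : Lx k E θ hθ a - Lx k E θ hθ b = Lx k E θ hθ (fun n => a n - b n) := by
  apply lp.ext
  funext n
  change Lx k E θ hθ a n - Lx k E θ hθ b n = _
  simp only [Lx_apply]
  split_ifs
  · rw [← sub_smul, mul_sub]
  · rw [sub_zero]

lemma Lx_norm (E0 : ℝ) (hE : ∀ n ∈ Finset.Icc (-(k : ℤ)) (k : ℤ), |E n| ≤ E0) (a : ℤ → ℂ) :
    ‖Lx k E θ hθ a‖ ≤ E0 * aNorm k a := by
  have h := hasSum_sum_of_ne_finset_zero (L := SummationFilter.unconditional ℤ) (f := fun n => ‖Lx k E θ hθ a n‖)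
    (s := Finset.Icc (-(k : ℤ)) (k : ℤ)) (by
      intro n hn
      rw [Lx_apply, if_neg hn, norm_zero])
  rw [(X_hasSum (Lx k E θ hθ a)).unique h, aNorm, Finset.mul_sum]
  refine Finset.sum_le_sum fun n hn => ?_
  rw [Lx_apply, if_pos hn, norm_smul, norm_mul, Complex.norm_real, Real.norm_eq_abs]
  have := hE n hn
  calc |E n| * ‖a n‖ * ‖qB (θ n) (hθ n)‖ ≤ E0 * ‖a n‖ * 1 := by
        gcongr
        · exact mul_nonneg ((abs_nonneg _).trans this) (norm_nonneg _)
        · exact qB_norm _ _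
    _ = _ := mul_one _

lemma Lx_Sym (hE : ∀ n, E (-n) = E n) (hθ' : ∀ n, θ (-n) = θ n) (a : ℤ → ℂ)
    (ha : ∀ n, a (-n) = (starRingEnd ℂ) (a n)) : Sym (Lx k E θ hθ a) := by
  intro n
  rw [Lx_apply, Lx_apply]
  by_cases hn : n ∈ Finset.Icc (-(k : ℤ)) (k : ℤ)
  · have hn' : -n ∈ Finset.Icc (-(k : ℤ)) (k : ℤ) := by
      rw [Finset.mem_Icc] at hn ⊢; omega
    rw [if_pos hn, if_pos hn']
    ext y
    change _ = (starRingEnd ℂ) (((E n : ℂ) * a n) * qB (θ n) (hθ n) y)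
    change ((E (-n) : ℂ) * a (-n)) * qB (θ (-n)) (hθ (-n)) y = _
    simp only [qB_apply, map_mul, Complex.conj_ofReal, hE, hθ', ha]
  · have hn' : -n ∉ Finset.Icc (-(k : ℤ)) (k : ℤ) := by
      rw [Finset.mem_Icc] at hn ⊢; omega
    rw [if_neg hn, if_neg hn', star_zero]

end

lemma Sym_closed : IsClosed {W : X | Sym W} := by
  have : {W : X | Sym W} = ⋂ n : ℤ, {W : X | W (-n) = star (W n)} := by
    ext W; simp [Sym]
  rw [this]
  refine isClosed_iInter fun n => isClosed_eq ?_ ?_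
  · exact (lp.evalCLM ℂ (fun _ : ℤ => B) 1 (-n)).continuous
  · exact continuous_star.comp (lp.evalCLM ℂ (fun _ : ℤ => B) 1 n).continuous

lemma Sym.add {W Z : X} (hW : Sym W) (hZ : Sym Z) : Sym (W + Z) := by
  intro n
  change W (-n) + Z (-n) = star (W n + Z n)
  rw [hW, hZ, star_add]

lemma Sym_zero : Sym (0 : X) := by
  intro n
  change (0 : B) = star (0 : B)
  rw [star_zero]

lemma banach (Φ : X → X) (S : Set X) (hS : IsClosed S) (h0 : (0 : X) ∈ S)
    (hm : Set.MapsTo Φ S S) (hc : ∀ W ∈ S, ∀ Z ∈ S, ‖Φ W - Φ Z‖ ≤ 1 / 2 * ‖W - Z‖) :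
    ∃ W ∈ S, Φ W = W := by
  have hcw : ContractingWith (1 / 2 : NNReal) (hm.restrict Φ S S) := by
    refine ⟨by rw [← NNReal.coe_lt_coe]; norm_num, LipschitzWith.of_dist_le_mul ?_⟩
    intro W Z
    rw [Subtype.dist_eq, Subtype.dist_eq, dist_eq_norm, dist_eq_norm]
    have := hc W W.2 Z Z.2
    simpa using this
  obtain ⟨y, hy, hf, -⟩ := hcw.exists_fixedPoint' hS.isComplete hm h0 (edist_ne_top _ _)
  exact ⟨y, hy, hf⟩

/-- abstract fixed point statement -/
lemma fix_exists (σ : ℝ) (hσ : 0 ≤ σ) (ν : ℝ) (hν : 0 < ν) (β : ℕ → ℝ) (K r0 : ℝ) (hK : 0 < K)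
    (hr0 : 0 < r0) (hβ : ∀ m, |β m| * r0 ^ m ≤ K * (1 / 2) ^ m)
    {κ : ℤ → ℝ} (md : ∀ n, Mode (κ n) ν) (hm : ∀ n G x, (md (-n)).V G x = (md n).V G x)
    (δ : ℝ) (hδ : 0 < δ) (hδν : δ * ν ≤ r0) (hδ2 : K * S0 * δ ^ 2 ≤ 1 / 2)
    (La : X) (hLs : Sym La) (hL : ‖La‖ ≤ δ * ν / 2) :
    ∃ W : X, ‖W‖ ≤ δ * ν ∧ Sym W ∧ La + TX md (NN σ hσ ν hν.le β W) = W := by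
  have key : ∀ W Z : X, ‖W‖ ≤ δ * ν → ‖Z‖ ≤ δ * ν →
      ‖TX md (NN σ hσ ν hν.le β W) - TX md (NN σ hσ ν hν.le β Z)‖ ≤ 1 / 2 * ‖W - Z‖ := by
    intro W Z hW hZ
    rw [← TX_sub]
    have h1 := NN_diff σ hσ ν hν.le β K r0 hr0.le hβ W Z (δ * ν) hδν hW hZ
    calc _ ≤ ‖NN σ hσ ν hν.le β W - NN σ hσ ν hν.le β Z‖ / ν ^ 2 := TX_norm md _
      _ ≤ (K * S0 * (δ * ν) ^ 2 * ‖W - Z‖) / ν ^ 2 := by gcongr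
      _ = K * S0 * δ ^ 2 * ‖W - Z‖ := by field_simp
      _ ≤ _ := by gcongr
  have T0 : TX md (NN σ hσ ν hν.le β 0) = 0 := by
    rw [NN_zero]
    have := TX_norm md 0
    rw [norm_zero, zero_div] at this
    exact norm_le_zero_iff.1 this
  have hδν0 : 0 ≤ δ * ν := by positivity
  obtain ⟨W, hW, hfix⟩ := banach (fun W => La + TX md (NN σ hσ ν hν.le β W))
    ({W : X | ‖W‖ ≤ δ * ν} ∩ {W : X | Sym W})
    ((isClosed_le continuous_norm continuous_const).inter Sym_closed)
    ⟨by simpa using hδν0, Sym_zero⟩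
    (by
      rintro W ⟨hW, hWs⟩
      constructor
      · have := key W 0 hW (by simpa using hδν0)
        rw [T0, sub_zero, sub_zero] at this
        have h2 := norm_add_le La (TX md (NN σ hσ ν hν.le β W))
        simp only [Set.mem_ofPred_eq] at hW ⊢
        linarith
      · exact hLs.add (TX_Sym md hm _ (hWs.NN σ hσ ν hν.le β
          (NN_summable σ hσ ν hν.le β K r0 hr0.le hβ W (hW.trans hδν)))))
    (by
      rintro W ⟨hW, -⟩ Z ⟨hZ, -⟩
      rw [add_sub_add_left_eq_sub]
      exact key W Z hW hZ)
  exact ⟨W, hW.1, hW.2, hfix⟩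

lemma fix_diff (σ : ℝ) (hσ : 0 ≤ σ) (ν : ℝ) (hν : 0 < ν) (β : ℕ → ℝ) (K r0 : ℝ) (hK : 0 < K)
    (hr0 : 0 < r0) (hβ : ∀ m, |β m| * r0 ^ m ≤ K * (1 / 2) ^ m)
    {κ : ℤ → ℝ} (md : ∀ n, Mode (κ n) ν)
    (δ : ℝ) (hδν : δ * ν ≤ r0) (hδ2 : K * S0 * δ ^ 2 ≤ 1 / 2)
    (La Lb W Z : X) (hW : ‖W‖ ≤ δ * ν) (hZ : ‖Z‖ ≤ δ * ν)
    (eW : La + TX md (NN σ hσ ν hν.le β W) = W) (eZ : Lb + TX md (NN σ hσ ν hν.le β Z) = Z) :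
    ‖W - Z‖ ≤ 2 * ‖La - Lb‖ := by
  have key : ‖TX md (NN σ hσ ν hν.le β W) - TX md (NN σ hσ ν hν.le β Z)‖ ≤ 1 / 2 * ‖W - Z‖ := by
    rw [← TX_sub]
    have h1 := NN_diff σ hσ ν hν.le β K r0 hr0.le hβ W Z (δ * ν) hδν hW hZ
    calc _ ≤ ‖NN σ hσ ν hν.le β W - NN σ hσ ν hν.le β Z‖ / ν ^ 2 := TX_norm md _
      _ ≤ (K * S0 * (δ * ν) ^ 2 * ‖W - Z‖) / ν ^ 2 := by gcongr
      _ = K * S0 * δ ^ 2 * ‖W - Z‖ := by field_simp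
      _ ≤ _ := by gcongr
  have e : W - Z = (La - Lb) + (TX md (NN σ hσ ν hν.le β W) - TX md (NN σ hσ ν hν.le β Z)) := by
    conv_lhs => rw [← eW, ← eZ]
    abel
  have h := norm_add_le (La - Lb) (TX md (NN σ hσ ν hν.le β W) - TX md (NN σ hσ ν hν.le β Z))
  rw [← e] at h
  linarith

end KG

namespace KG

/-- Fourier modes -/
def em (n : ℤ) (τ : ℝ) : ℂ := Complex.exp (Complex.I * (n : ℂ) * (τ : ℂ))

lemma em_norm (n : ℤ) (τ : ℝ) : ‖em n τ‖ = 1 := norm_cexp n τ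

lemma em_cont (n : ℤ) : Continuous (em n) := by unfold em; fun_prop

lemma em_period (n : ℤ) (τ : ℝ) : em n (τ + 2 * Real.pi) = em n τ := by
  unfold em
  have : Complex.I * (n : ℂ) * ((τ + 2 * Real.pi : ℝ) : ℂ)
      = Complex.I * (n : ℂ) * (τ : ℂ) + (n : ℂ) * (2 * Real.pi * Complex.I) := by push_cast; ring
  rw [this, Complex.exp_add, Complex.exp_int_mul_two_pi_mul_I, mul_one]

lemma em_deriv (n : ℤ) (τ : ℝ) : HasDerivAt (em n) (Complex.I * n * em n τ) τ := by
  have h1 : HasDerivAt (fun τ : ℝ => Complex.I * (n : ℂ) * (τ : ℂ)) (Complex.I * n) τ := by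
    simpa using (Complex.ofRealCLM.hasDerivAt (x := τ)).const_mul (Complex.I * (n : ℂ))
  have := h1.cexp
  refine this.congr_deriv ?_
  rw [mul_comm]; rfl

lemma em_orth (n m : ℤ) : ∫ τ in (0 : ℝ)..(2 * Real.pi),
    em n τ * Complex.exp (-(Complex.I * (m : ℂ) * (τ : ℂ))) = if n = m then 2 * Real.pi else 0 := by
  have e : ∀ τ : ℝ, em n τ * Complex.exp (-(Complex.I * (m : ℂ) * (τ : ℂ)))
      = Complex.exp ((Complex.I * ((n : ℂ) - m)) * τ) := by
    intro τ
    unfold em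
    rw [← Complex.exp_add]
    congr 1; ring
  simp only [e]
  split_ifs with h
  · subst h
    simp
  · have hne : Complex.I * ((n : ℂ) - m) ≠ 0 := by
      refine mul_ne_zero Complex.I_ne_zero (sub_ne_zero.2 ?_)
      exact_mod_cast h
    rw [integral_exp_mul_complex hne]
    have : Complex.I * ((n : ℂ) - m) * ((2 * Real.pi : ℝ) : ℂ)
        = ((n - m : ℤ) : ℂ) * (2 * Real.pi * Complex.I) := by push_cast; ring
    rw [this, Complex.exp_int_mul_two_pi_mul_I]
    simp

lemma eCoeff_tsum (c : ℤ → ℂ) (hc : Summable fun n => ‖c n‖) (m : ℤ) :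
    eCoeff (fun τ => ∑' n, c n * em n τ) m = c m := by
  unfold eCoeff
  have hs := intervalIntegral.hasSum_integral_of_dominated_convergence (a := 0) (b := 2 * Real.pi)
    (μ := volume)
    (F := fun n τ => c n * em n τ * Complex.exp (-(Complex.I * (m : ℂ) * (τ : ℂ))))
    (f := fun τ => (∑' n, c n * em n τ) * Complex.exp (-(Complex.I * (m : ℂ) * (τ : ℂ))))
    (fun n _ => ‖c n‖)
    (fun n => by
      have := em_cont n
      exact (Continuous.aestronglyMeasurable (by fun_prop)))
    (fun n => by
      refine Filter.Eventually.of_forall fun τ _ => ?_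
      have h2 : ‖Complex.exp (-(Complex.I * (m : ℂ) * (τ : ℂ)))‖ = 1 := by
        have := em_norm (-m) τ
        unfold em at this
        rw [← this]; congr 2; push_cast; ring
      rw [norm_mul, norm_mul, em_norm, h2, mul_one, mul_one])
    (Filter.Eventually.of_forall fun τ _ => hc)
    (by simp)
    (Filter.Eventually.of_forall fun τ _ => by
      refine HasSum.mul_right _ (Summable.hasSum ?_)
      refine Summable.of_norm ?_
      simpa [em_norm] using hc)
  have e : ∀ n, ∫ τ in (0 : ℝ)..(2 * Real.pi),
      c n * em n τ * Complex.exp (-(Complex.I * (m : ℂ) * (τ : ℂ)))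
      = if n = m then c m * (2 * Real.pi) else 0 := by
    intro n
    simp only [mul_assoc (c n)]
    rw [intervalIntegral.integral_const_mul, em_orth]
    split_ifs with h
    · rw [h]; push_cast; rfl
    · simp
  simp only [e] at hs
  have h2 := hasSum_ite_eq m (c m * (2 * (Real.pi : ℂ)))
  rw [hs.unique h2]
  have : (Real.pi : ℂ) ≠ 0 := by exact_mod_cast Real.pi_ne_zero
  field_simp

lemma l1C_le (v : ℝ → ℂ) (c : ℤ → ℂ) (b : ℤ → ℝ) (C : ℝ) (hb : HasSum b C)
    (h : ∀ n, ‖c n‖ ≤ b n) (hv : ∀ τ, v τ = ∑' n, c n * em n τ) : l1C v ≤ ENNReal.ofReal C := by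
  have hc : Summable fun n => ‖c n‖ := Summable.of_nonneg_of_le (fun _ => norm_nonneg _) h hb.summable
  have : v = fun τ => ∑' n, c n * em n τ := funext hv
  rw [this]
  unfold l1C
  simp only [eCoeff_tsum c hc]
  rw [← hb.tsum_eq, ENNReal.ofReal_tsum_of_nonneg (fun n => (norm_nonneg _).trans (h n)) hb.summable]
  refine ENNReal.tsum_le_tsum fun n => ?_
  change ‖c n‖ₑ ≤ _
  rw [← ofReal_norm]
  exact ENNReal.ofReal_le_ofReal (h n)

lemma exp_summable (σ : ℝ) (hσ : 0 < σ) :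
    Summable fun n : ℤ => (1 + (n : ℝ) ^ 2) * Real.exp (-(σ * (|n| : ℤ))) := by
  have h : Summable fun n : ℕ => (1 + (n : ℝ) ^ 2) * Real.exp (-(σ * n)) := by
    have h0 := Real.summable_pow_mul_exp_neg_nat_mul 0 hσ
    have h2 := Real.summable_pow_mul_exp_neg_nat_mul 2 hσ
    refine (h0.add h2).congr fun n => ?_
    rw [neg_mul]; ring
  refine Summable.of_nat_of_neg ?_ ?_
  · refine h.congr fun n => ?_
    simp
  · refine h.congr fun n => ?_
    simp

lemma real_deriv (v : ℝ → ℝ) (Uc : ℝ → ℂ) (D : ℂ) (x : ℝ) (h : HasDerivAt Uc D x)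
    (he : ∀ᶠ y in 𝓝 x, ((v y : ℝ) : ℂ) = Uc y) : ((deriv v x : ℝ) : ℂ) = D := by
  have h1 : HasDerivAt (fun y => ((v y : ℝ) : ℂ)) D x := h.congr_of_eventuallyEq he
  have h2 : HasDerivAt v D.re x := by
    have := Complex.reCLM.hasFDerivAt.comp_hasDerivAt x h1
    simpa [Function.comp_def] using this
  rw [h2.deriv]
  exact h2.ofReal_comp.unique h1

lemma core (ω : ℝ) (w w' F : ℤ → ℝ → ℂ) (b0 b1 b2 : ℤ → ℝ) (s0 : Summable b0) (s1 : Summable b1)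
    (s2 : Summable b2) (hw : ∀ n y, HasDerivAt (w n) (w' n y) y)
    (hw' : ∀ n y, HasDerivAt (w' n) (((1 - (n : ℝ) ^ 2 * ω ^ 2 : ℝ) : ℂ) * w n y - F n y) y)
    (h0 : ∀ (n : ℤ) (y : ℝ), 0 < y → (1 + (n : ℝ) ^ 2) * ‖w n y‖ ≤ b0 n)
    (h1 : ∀ n y, 0 < y → ‖w' n y‖ ≤ b1 n)
    (h2 : ∀ n y, 0 < y → ‖F n y‖ ≤ b2 n)
    (u : ℝ → ℝ → ℝ) (hu : ∀ x, -1 < x → ∀ τ, ((u x τ : ℝ) : ℂ) = ∑' n, w n (x + 1) * em n τ) :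
    ∀ x, -1 < x → ∀ τ, ((deriv (fun x => u x τ) x : ℝ) : ℂ) = ∑' n, w' n (x + 1) * em n τ ∧
      ((ω ^ 2 * deriv (fun s => deriv (fun s' => u x s') s) τ
        - deriv (fun s => deriv (fun s' => u s' τ) s) x + u x τ : ℝ) : ℂ)
        = ∑' n, F n (x + 1) * em n τ := by
  have w0 : ∀ n y, 0 < y → ‖w n y‖ ≤ b0 n := by
    intro n y hy
    refine le_trans ?_ (h0 n y hy)
    nlinarith [norm_nonneg (w n y), mul_nonneg (sq_nonneg (n : ℝ)) (norm_nonneg (w n y))]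
  have w1 : ∀ (n : ℤ) (y : ℝ), 0 < y → ‖(n : ℂ) * w n y‖ ≤ b0 n := by
    intro n y hy
    refine le_trans ?_ (h0 n y hy)
    rw [norm_mul, Complex.norm_intCast]
    gcongr
    nlinarith [sq_nonneg (|(n : ℝ)| - 1), sq_abs (n : ℝ)]
  have w2 : ∀ (n : ℤ) (y : ℝ), 0 < y → ‖(n : ℂ) ^ 2 * w n y‖ ≤ b0 n := by
    intro n y hy
    refine le_trans ?_ (h0 n y hy)
    rw [norm_mul, norm_pow, Complex.norm_intCast, sq_abs]
    gcongr
    linarith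
  have sw : ∀ y, 0 < y → ∀ τ, Summable fun n => w n y * em n τ := by
    intro y hy τ
    refine Summable.of_norm_bounded s0 fun n => ?_
    rw [norm_mul, em_norm, mul_one]; exact w0 n y hy
  have sw1 : ∀ y, 0 < y → ∀ τ, Summable fun n => w' n y * em n τ := by
    intro y hy τ
    refine Summable.of_norm_bounded s1 fun n => ?_
    rw [norm_mul, em_norm, mul_one]; exact h1 n y hy
  have sw2 : ∀ y, 0 < y → ∀ τ, Summable fun n : ℤ => ((n : ℂ) ^ 2 * w n y) * em n τ := by
    intro y hy τ
    refine Summable.of_norm_bounded s0 fun n => ?_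
    rw [norm_mul, em_norm, mul_one]; exact w2 n y hy
  have swn : ∀ y, 0 < y → ∀ τ, Summable fun n : ℤ => w n y * (Complex.I * n * em n τ) := by
    intro y hy τ
    refine Summable.of_norm_bounded s0 fun n => ?_
    have : w n y * (Complex.I * n * em n τ) = ((n : ℂ) * w n y) * (Complex.I * em n τ) := by ring
    rw [this, norm_mul, norm_mul Complex.I, em_norm, Complex.norm_I, mul_one, mul_one]
    exact w1 n y hy
  have sF : ∀ y, 0 < y → ∀ τ, Summable fun n => F n y * em n τ := by
    intro y hy τ
    refine Summable.of_norm_bounded s2 fun n => ?_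
    rw [norm_mul, em_norm, mul_one]; exact h2 n y hy
  -- termwise derivatives
  have dy : ∀ y, 0 < y → ∀ τ,
      HasDerivAt (fun y => ∑' n, w n y * em n τ) (∑' n, w' n y * em n τ) y := by
    intro y hy τ
    refine hasDerivAt_tsum_of_isPreconnected s1 isOpen_Ioi isPreconnected_Ioi
      (t := Set.Ioi 0) (y₀ := y) (g := fun n y => w n y * em n τ)
      (g' := fun n y => w' n y * em n τ) ?_ ?_ hy (sw y hy τ) hy
    · intro n z _
      exact (hw n z).mul_const _
    · intro n z hz
      rw [norm_mul, em_norm, mul_one]; exact h1 n z hz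
  have dyy : ∀ y, 0 < y → ∀ τ,
      HasDerivAt (fun y => ∑' n, w' n y * em n τ)
        (∑' n : ℤ, ((((1 - (n : ℝ) ^ 2 * ω ^ 2 : ℝ) : ℂ) * w n y - F n y)) * em n τ) y := by
    intro y hy τ
    refine hasDerivAt_tsum_of_isPreconnected (u := fun n => (1 + ω ^ 2) * b0 n + b2 n)
      ((s0.mul_left _).add s2) isOpen_Ioi isPreconnected_Ioi
      (t := Set.Ioi 0) (y₀ := y) (g := fun n y => w' n y * em n τ)
      (g' := fun n y => ((((1 - (n : ℝ) ^ 2 * ω ^ 2 : ℝ) : ℂ) * w n y - F n y)) * em n τ)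
      ?_ ?_ hy (sw1 y hy τ) hy
    · intro n z _
      exact (hw' n z).mul_const _
    · intro n z hz
      rw [norm_mul, em_norm, mul_one]
      refine (norm_sub_le _ _).trans (add_le_add ?_ (h2 n z hz))
      have e : ((1 - (n : ℝ) ^ 2 * ω ^ 2 : ℝ) : ℂ) * w n z
          = w n z - ((ω ^ 2 : ℝ) : ℂ) * ((n : ℂ) ^ 2 * w n z) := by push_cast; ring
      rw [e]
      refine (norm_sub_le _ _).trans ?_
      rw [norm_mul, Complex.norm_real, Real.norm_of_nonneg (sq_nonneg ω), add_mul, one_mul]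
      exact add_le_add (w0 n z hz) (mul_le_mul_of_nonneg_left (w2 n z hz) (sq_nonneg ω))
  have dτ : ∀ y, 0 < y → ∀ τ, HasDerivAt (fun τ => ∑' n, w n y * em n τ)
      (∑' n : ℤ, w n y * (Complex.I * n * em n τ)) τ := by
    intro y hy τ
    refine hasDerivAt_tsum (u := b0) (g := fun n τ => w n y * em n τ)
      (g' := fun n τ => w n y * (Complex.I * n * em n τ)) (y₀ := 0) s0 ?_ ?_ (sw y hy 0) τ
    · intro n t
      exact (em_deriv n t).const_mul _
    · intro n t
      have : w n y * (Complex.I * n * em n t) = ((n : ℂ) * w n y) * (Complex.I * em n t) := by ring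
      rw [this, norm_mul, norm_mul Complex.I, em_norm, Complex.norm_I, mul_one, mul_one]
      exact w1 n y hy
  have dττ : ∀ y, 0 < y → ∀ τ, HasDerivAt (fun τ => ∑' n : ℤ, w n y * (Complex.I * n * em n τ))
      (∑' n : ℤ, -(((n : ℂ) ^ 2 * w n y) * em n τ)) τ := by
    intro y hy τ
    refine hasDerivAt_tsum (u := b0) (g := fun (n : ℤ) τ => w n y * (Complex.I * n * em n τ))
      (g' := fun (n : ℤ) τ => -(((n : ℂ) ^ 2 * w n y) * em n τ)) (y₀ := 0) s0 ?_ ?_ (swn y hy 0) τ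
    · intro n t
      refine (((em_deriv n t).const_mul (Complex.I * n)).const_mul (w n y)).congr_deriv ?_
      linear_combination ((n : ℂ) ^ 2 * w n y * em n t) * Complex.I_mul_I
    · intro n t
      rw [norm_neg, norm_mul, em_norm, mul_one]
      exact w2 n y hy
  intro x hx τ
  have rx : ∀ x, -1 < x → ((deriv (fun x => u x τ) x : ℝ) : ℂ) = ∑' n, w' n (x + 1) * em n τ := by
    intro x hx
    refine real_deriv _ (fun x => ∑' n, w n (x + 1) * em n τ) _ x
      ((dy (x + 1) (by linarith) τ).comp_add_const x 1) ?_
    filter_upwards [isOpen_Ioi.mem_nhds hx] with z hz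
    exact hu z hz τ
  have rxx : ((deriv (fun s => deriv (fun s' => u s' τ) s) x : ℝ) : ℂ)
      = ∑' n : ℤ, ((((1 - (n : ℝ) ^ 2 * ω ^ 2 : ℝ) : ℂ) * w n (x + 1) - F n (x + 1))) * em n τ := by
    refine real_deriv _ (fun x => ∑' n, w' n (x + 1) * em n τ) _ x
      ((dyy (x + 1) (by linarith) τ).comp_add_const x 1) ?_
    filter_upwards [isOpen_Ioi.mem_nhds hx] with z hz
    exact rx z hz
  have rt : ∀ τ, ((deriv (fun s' => u x s') τ : ℝ) : ℂ)
      = ∑' n : ℤ, w n (x + 1) * (Complex.I * n * em n τ) := by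
    intro τ
    refine real_deriv _ (fun τ => ∑' n, w n (x + 1) * em n τ) _ τ (dτ (x + 1) (by linarith) τ) ?_
    exact Filter.Eventually.of_forall fun t => hu x hx t
  have rtt : ((deriv (fun s => deriv (fun s' => u x s') s) τ : ℝ) : ℂ)
      = ∑' n : ℤ, -(((n : ℂ) ^ 2 * w n (x + 1)) * em n τ) := by
    refine real_deriv _ (fun τ => ∑' n : ℤ, w n (x + 1) * (Complex.I * n * em n τ)) _ τ
      (dττ (x + 1) (by linarith) τ) ?_
    exact Filter.Eventually.of_forall fun t => rt t
  refine ⟨rx x hx, ?_⟩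
  have hy : 0 < x + 1 := by linarith
  rw [Complex.ofReal_add, Complex.ofReal_sub, Complex.ofReal_mul, rxx, rtt, hu x hx τ]
  have A := (sw (x + 1) hy τ).hasSum
  have B2 := (sw2 (x + 1) hy τ).hasSum
  have C := (sF (x + 1) hy τ).hasSum
  have D := (A.sub (B2.mul_left ((ω : ℂ) ^ 2))).sub C
  have e : ∀ n : ℤ, (((1 - (n : ℝ) ^ 2 * ω ^ 2 : ℝ) : ℂ) * w n (x + 1) - F n (x + 1)) * em n τ
      = w n (x + 1) * em n τ - (ω : ℂ) ^ 2 * ((n : ℂ) ^ 2 * w n (x + 1) * em n τ)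
        - F n (x + 1) * em n τ := by
    intro n; push_cast; ring
  simp only [e]
  rw [D.tsum_eq, tsum_neg]
  push_cast
  ring

end KG

namespace KG

/-- exponential weights -/
def xw (σ : ℝ) (n : ℤ) : ℝ := Real.exp (-(σ * (|n| : ℤ)))

lemma xw_pos (σ : ℝ) (n : ℤ) : 0 < xw σ n := Real.exp_pos _

lemma xw_le (σ : ℝ) (hσ : 0 ≤ σ) (n : ℤ) : xw σ n ≤ 1 := by
  unfold xw
  rw [Real.exp_le_one_iff, neg_nonpos]
  exact mul_nonneg hσ (by exact_mod_cast abs_nonneg n)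

lemma ew_eq (σ τ : ℝ) (n : ℤ) : ew σ τ n = (xw σ n : ℂ) * em n τ := rfl

section
variable {κ : ℤ → ℝ} {ν : ℝ} (md : ∀ n, Mode (κ n) ν) (σ : ℝ)

/-- coefficients of the first nonlinear component -/
def o1 (g : X) (n : ℤ) (y : ℝ) : ℂ := (xw σ n : ℂ) * (md n).V (gG ν (g n)) y

/-- coefficients of the second nonlinear component -/
def o2 (g : X) (n : ℤ) (y : ℝ) : ℂ := (xw σ n : ℂ) * (md n).V' (gG ν (g n)) y

lemma o1_norm (hν : 0 < ν) (hσ : 0 ≤ σ) (g : X) (n : ℤ) (y : ℝ) (hy : 0 ≤ y) : ‖o1 md σ g n y‖ ≤ ‖g n‖ / ν ^ 2 := by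
  have h := (md n).b1 _ (gG_GG ν (g n)) ‖g n‖ (fun s _ => gG_bound ν (g n) s) y hy
  have h2 : Real.exp (-ν * y) ≤ 1 := by
    rw [Real.exp_le_one_iff]; nlinarith
  unfold o1
  rw [norm_mul, Complex.norm_real, Real.norm_of_nonneg (xw_pos σ n).le]
  calc _ ≤ 1 * (‖g n‖ / ν ^ 2 * Real.exp (-ν * y)) := by
        gcongr; exact xw_le σ hσ n
    _ ≤ 1 * (‖g n‖ / ν ^ 2 * 1) := by gcongr
    _ = _ := by ring

lemma o2_norm (hν : 0 < ν) (hσ : 0 ≤ σ) (g : X) (n : ℤ) (y : ℝ) (hy : 0 ≤ y) : ‖o2 md σ g n y‖ ≤ ‖g n‖ / ν := by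
  have h := (md n).b2 _ (gG_GG ν (g n)) ‖g n‖ (fun s _ => gG_bound ν (g n) s) y hy
  have h2 : Real.exp (-ν * y) ≤ 1 := by
    rw [Real.exp_le_one_iff]; nlinarith
  unfold o2
  rw [norm_mul, Complex.norm_real, Real.norm_of_nonneg (xw_pos σ n).le]
  calc _ ≤ 1 * (‖g n‖ / ν * Real.exp (-ν * y)) := by
        gcongr; exact xw_le σ hσ n
    _ ≤ 1 * (‖g n‖ / ν * 1) := by gcongr
    _ = _ := by ring

lemma o1_sub (g h : X) (n : ℤ) (y : ℝ) : o1 md σ (g - h) n y = o1 md σ g n y - o1 md σ h n y := by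
  unfold o1
  change _ * (md n).V (gG ν (g n - h n)) y = _
  rw [gG_sub, (md n).sub1 _ _ (gG_GG ν (g n)) (gG_GG ν (h n)), mul_sub]

lemma o2_sub (g h : X) (n : ℤ) (y : ℝ) : o2 md σ (g - h) n y = o2 md σ g n y - o2 md σ h n y := by
  unfold o2
  change _ * (md n).V' (gG ν (g n - h n)) y = _
  rw [gG_sub, (md n).sub2 _ _ (gG_GG ν (g n)) (gG_GG ν (h n)), mul_sub]

lemma o1_summable (hν : 0 < ν) (hσ : 0 ≤ σ) (g : X) (y : ℝ) (hy : 0 ≤ y) (τ : ℝ) : Summable fun n => o1 md σ g n y * em n τ := by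
  refine Summable.of_norm_bounded ((X_summable g).div_const (ν ^ 2)) fun n => ?_
  rw [norm_mul, em_norm, mul_one]
  exact o1_norm md σ hν hσ g n y hy

lemma o2_summable (hν : 0 < ν) (hσ : 0 ≤ σ) (g : X) (y : ℝ) (hy : 0 ≤ y) (τ : ℝ) : Summable fun n => o2 md σ g n y * em n τ := by
  refine Summable.of_norm_bounded ((X_summable g).div_const ν) fun n => ?_
  rw [norm_mul, em_norm, mul_one]
  exact o2_norm md σ hν hσ g n y hy

lemma O1_diff (hν : 0 < ν) (hσ : 0 ≤ σ) (g h : X) : l1C (fun τ => (∑' n, o1 md σ g n 1 * em n τ) - ∑' n, o1 md σ h n 1 * em n τ)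
    ≤ ENNReal.ofReal (‖g - h‖ / ν ^ 2) := by
  refine l1C_le _ (fun n => o1 md σ (g - h) n 1) _ _ ((X_hasSum (g - h)).div_const _)
    (fun n => o1_norm md σ hν hσ (g - h) n 1 zero_le_one) fun τ => ?_
  rw [← (o1_summable md σ hν hσ g 1 zero_le_one τ).tsum_sub (o1_summable md σ hν hσ h 1 zero_le_one τ)]
  refine tsum_congr fun n => ?_
  rw [o1_sub, sub_mul]

lemma O2_diff (hν : 0 < ν) (hσ : 0 ≤ σ) (g h : X) : l1C (fun τ => (∑' n, o2 md σ g n 1 * em n τ) - ∑' n, o2 md σ h n 1 * em n τ)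
    ≤ ENNReal.ofReal (‖g - h‖ / ν) := by
  refine l1C_le _ (fun n => o2 md σ (g - h) n 1) _ _ ((X_hasSum (g - h)).div_const _)
    (fun n => o2_norm md σ hν hσ (g - h) n 1 zero_le_one) fun τ => ?_
  rw [← (o2_summable md σ hν hσ g 1 zero_le_one τ).tsum_sub (o2_summable md σ hν hσ h 1 zero_le_one τ)]
  refine tsum_congr fun n => ?_
  rw [o2_sub, sub_mul]

end

lemma l1C_neg (v : ℝ → ℂ) : l1C (fun τ => -v τ) = l1C v := by
  unfold l1C
  refine tsum_congr fun n => ?_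
  have : eCoeff (fun τ => -v τ) n = -eCoeff v n := by
    unfold eCoeff
    simp only [neg_mul, intervalIntegral.integral_neg, mul_neg]
  rw [this, nnnorm_neg]

lemma J_facts (ε₀ : ℝ) (k : ℕ) (ω : ℝ) (h : ω ∈ Jset ε₀ k) (hε : 0 < ε₀) :
    0 < nuKG ω k ∧ nuKG ω k ≤ 1 ∧
    (∀ n ∈ Finset.Icc (-(k : ℤ)) (k : ℤ), nuKG ω k ^ 2 ≤ 1 - (n : ℝ) ^ 2 * ω ^ 2) ∧
    (∀ n : ℤ, n ∉ Finset.Icc (-(k : ℤ)) (k : ℤ) → 1 - (n : ℝ) ^ 2 * ω ^ 2 ≤ 0) := by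
  have hω : 1 / ((k : ℝ) + 1) ≤ ω := by
    unfold Jset at h
    split_ifs at h with hk
    · subst hk; simpa using h
    · exact h.1
  have hω0 : 0 < ω := lt_of_lt_of_le (by positivity) hω
  have hω1 : 1 ≤ ω * ((k : ℝ) + 1) := by
    rwa [div_le_iff₀ (by positivity)] at hω
  have hup : 0 < 1 - ((k : ℤ) : ℝ) ^ 2 * ω ^ 2 := by
    unfold Jset at h
    split_ifs at h with hk
    · subst hk; simp
    · have hk' : 0 < (k : ℝ) := by exact_mod_cast Nat.pos_of_ne_zero hk
      have hpos : 0 < (k : ℝ) * (k + ε₀ ^ 2) := by positivity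
      have h2 := h.2
      rw [lt_div_iff₀ (Real.sqrt_pos.2 hpos)] at h2
      have h3 : (ω * Real.sqrt (k * (k + ε₀ ^ 2))) ^ 2 < 1 := by
        have : 0 ≤ ω * Real.sqrt (k * (k + ε₀ ^ 2)) := by positivity
        nlinarith
      rw [mul_pow, Real.sq_sqrt hpos.le] at h3
      push_cast
      have : 0 < ω ^ 2 * (k * ε₀ ^ 2) := by positivity
      nlinarith
  have hsq : nuKG ω k ^ 2 = 1 - ((k : ℤ) : ℝ) ^ 2 * ω ^ 2 := Real.sq_sqrt hup.le
  refine ⟨Real.sqrt_pos.2 hup, ?_, ?_, ?_⟩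
  · unfold nuKG
    refine Real.sqrt_le_iff.2 ⟨zero_le_one, ?_⟩
    have : 0 ≤ ((k : ℤ) : ℝ) ^ 2 * ω ^ 2 := by positivity
    rw [one_pow]
    linarith
  · intro n hn
    rw [hsq]
    rw [Finset.mem_Icc] at hn
    have : (n : ℝ) ^ 2 ≤ ((k : ℤ) : ℝ) ^ 2 := by
      have : n ^ 2 ≤ (k : ℤ) ^ 2 := by nlinarith [hn.1, hn.2]
      exact_mod_cast this
    have := mul_le_mul_of_nonneg_right this (sq_nonneg ω)
    linarith
  · intro n hn
    rw [Finset.mem_Icc] at hn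
    have h1 : ((k : ℝ) + 1) ^ 2 ≤ (n : ℝ) ^ 2 := by
      have : ((k : ℤ) + 1) ^ 2 ≤ n ^ 2 := by
        rcases lt_or_ge n (-(k : ℤ)) with h | h
        · nlinarith
        · have : (k : ℤ) < n := by
            by_contra h'
            exact hn ⟨h, not_lt.1 h'⟩
          nlinarith
      exact_mod_cast this
    have h2 := mul_le_mul_of_nonneg_right h1 (sq_nonneg ω)
    nlinarith

end KG

namespace KG

/-- linear weights -/
def Ew (σ ω : ℝ) (n : ℤ) : ℝ := Real.exp (σ * (|n| : ℤ)) * Real.exp (nuKG ω n)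

/-- exponents -/
def th (ω ν : ℝ) (n : ℤ) : ℝ := max (nuKG ω n - ν) 0

lemma th_nonneg (ω ν : ℝ) (n : ℤ) : 0 ≤ th ω ν n := le_max_right _ _

lemma nuKG_neg (ω : ℝ) (n : ℤ) : nuKG ω (-n) = nuKG ω n := by
  unfold nuKG; push_cast; rw [neg_sq]

lemma nuKG_nonneg (ω : ℝ) (n : ℤ) : 0 ≤ nuKG ω n := Real.sqrt_nonneg _

lemma nuKG_le (ω : ℝ) (n : ℤ) : nuKG ω n ≤ 1 := by
  unfold nuKG
  refine Real.sqrt_le_iff.2 ⟨zero_le_one, ?_⟩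
  have : 0 ≤ (n : ℝ) ^ 2 * ω ^ 2 := by positivity
  rw [one_pow]
  linarith

lemma lin_deriv (c : ℂ) (μ y : ℝ) :
    HasDerivAt (fun y : ℝ => c * ((Real.exp (μ * (1 - y)) : ℝ) : ℂ))
      (-(μ : ℂ) * (c * ((Real.exp (μ * (1 - y)) : ℝ) : ℂ))) y := by
  have h : HasDerivAt (fun y : ℝ => Real.exp (μ * (1 - y))) (Real.exp (μ * (1 - y)) * (μ * -1)) y :=
    (((hasDerivAt_id y).const_sub 1).const_mul μ).exp
  refine (h.ofReal_comp.const_mul c).congr_deriv ?_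
  push_cast; ring

lemma stable_sol (f : ℂ → ℂ) (β : ℕ → ℝ) (K r0 : ℝ) (hr0 : 0 < r0)
    (hβ : ∀ m, |β m| * r0 ^ m ≤ K * (1 / 2) ^ m)
    (hfs : ∀ x : ℝ, |x| ≤ r0 → HasSum (fun m => β m * x ^ (m + 3)) (1 / 3 * x ^ 3 + (f x).re))
    (k : ℕ) (ω ν : ℝ) (hν : 0 < ν)
    (hin : ∀ n ∈ Finset.Icc (-(k : ℤ)) (k : ℤ), ν ^ 2 ≤ 1 - (n : ℝ) ^ 2 * ω ^ 2)
    (md : ∀ n : ℤ, Mode (1 - (n : ℝ) ^ 2 * ω ^ 2) ν) (σ : ℝ) (hσ : 0 < σ)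
    (a : ℤ → ℂ) (ha : ∀ n : ℤ, n ∉ Finset.Icc (-(k : ℤ)) (k : ℤ) → a n = 0)
    (W : X) (hW : ‖W‖ ≤ r0) (hS : Sym W)
    (hfix : Lx k (Ew σ ω) (th ω ν) (th_nonneg ω ν) a + TX md (NN σ hσ.le ν hν.le β W) = W) :
    ∃ u : ℝ → ℝ → ℝ,
      IsTauKGSolutionOn f ω (Set.Ici 0) u ∧
      (∀ x ∈ Set.Ici (0 : ℝ), ∀ τ, u x (τ + 2 * Real.pi) = u x τ) ∧
      (∀ τ, ((u 0 τ : ℝ) : ℂ) = linPart k (fun _ => 1) a τ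
        + ∑' n, o1 md σ (NN σ hσ.le ν hν.le β W) n 1 * em n τ) ∧
      (∀ τ, ((deriv (fun x => u x τ) 0 : ℝ) : ℂ)
          = linPart k (fun n => -nuKG ω n) a τ
        + ∑' n, o2 md σ (NN σ hσ.le ν hν.le β W) n 1 * em n τ) ∧
      ∃ C : ℝ, ∀ x : ℝ, 0 ≤ x →
        ENNReal.ofReal (Real.exp (ν * x)) * l1R (u x) ≤ ENNReal.ofReal C := by
  set g := NN σ hσ.le ν hν.le β W with hg
  let lin : ℤ → ℝ → ℂ := fun n y => a n * ((Real.exp (nuKG ω n * (1 - y)) : ℝ) : ℂ)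
  let w : ℤ → ℝ → ℂ := fun n y => lin n y + o1 md σ g n y
  let w' : ℤ → ℝ → ℂ := fun n y => -(nuKG ω n : ℂ) * lin n y + o2 md σ g n y
  let F : ℤ → ℝ → ℂ := fun n y => (xw σ n : ℂ) * gG ν (g n) y
  let u : ℝ → ℝ → ℝ := fun x τ => (qB ν hν.le (x + 1) * ev σ hσ.le (x + 1) τ W).re
  have hq : ∀ y, 0 ≤ y → qB ν hν.le y = ((Real.exp (-(ν * y)) : ℝ) : ℂ) := by
    intro y hy
    rw [qB_apply, max_eq_left hy]
  have hwW : ∀ n y, 0 ≤ y → w n y = (xw σ n : ℂ) * (qB ν hν.le y * W n y) := by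
    intro n y hy
    have e : W n y = Lx k (Ew σ ω) (th ω ν) (th_nonneg ω ν) a n y + TX md g n y := by
      conv_lhs => rw [← hfix]
      rfl
    rw [e, TX_apply, TB_apply, max_eq_left hy, hq y hy, mul_add, mul_add]
    change lin n y + o1 md σ g n y = _
    congr 1
    · rw [Lx_apply]
      split_ifs with hn
      · have h1 : th ω ν n = nuKG ω n - ν := by
          unfold th
          rw [max_eq_left]
          rw [sub_nonneg]
          exact Real.le_sqrt_of_sq_le (hin n hn)
        change _ = (xw σ n : ℂ) * (_ * (((Ew σ ω n : ℂ) * a n) * qB (th ω ν n) _ y))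
        rw [qB_apply, max_eq_left hy, h1]
        have h2 : Real.exp (nuKG ω n * (1 - y))
            = xw σ n * Real.exp (-(ν * y)) * Ew σ ω n * Real.exp (-((nuKG ω n - ν) * y)) := by
          unfold xw Ew
          simp only [← Real.exp_add]
          congr 1; ring
        simp only [lin]
        rw [h2]
        push_cast; ring
      · simp only [lin]
        rw [ha n hn]
        simp
    · unfold o1
      have h2 : Real.exp (-(ν * y)) * Real.exp (ν * y) = 1 := by
        rw [← Real.exp_add]; simp
      rw [← mul_assoc ((Real.exp (-(ν * y)) : ℝ) : ℂ), ← Complex.ofReal_mul, h2]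
      simp
  have hWn : ∀ n y, 0 ≤ y → ‖w n y‖ ≤ xw σ n * (Real.exp (-(ν * y)) * ‖W n‖) := by
    intro n y hy
    rw [hwW n y hy, hq y hy, norm_mul, norm_mul, Complex.norm_real, Complex.norm_real,
      Real.norm_of_nonneg (xw_pos σ n).le, Real.norm_of_nonneg (Real.exp_pos _).le]
    gcongr
    · exact (xw_pos σ n).le
    · exact (W n).norm_coe_le_norm y
  have hUW : ∀ y, 0 ≤ y → ∀ τ, ∑' n, w n y * em n τ = qB ν hν.le y * ev σ hσ.le y τ W := by
    intro y hy τ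
    rw [ev_apply, ← tsum_mul_left]
    refine tsum_congr fun n => ?_
    rw [hwW n y hy, ew_eq]; ring
  have huC : ∀ x τ, ((u x τ : ℝ) : ℂ) = qB ν hν.le (x + 1) * ev σ hσ.le (x + 1) τ W := by
    intro x τ
    apply Complex.ext
    · simp [u]
    · rw [Complex.ofReal_im, Complex.mul_im, hS.ev_im, qB_apply, Complex.ofReal_im]
      simp
  have hu : ∀ x, -1 < x → ∀ τ, ((u x τ : ℝ) : ℂ) = ∑' n, w n (x + 1) * em n τ := by
    intro x hx τ
    rw [huC, hUW (x + 1) (by linarith)]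
  have hFs : ∀ y, 0 ≤ y → ∀ τ, ∑' n, F n y * em n τ = (qB ν hν.le y) ^ 3 * ev σ hσ.le y τ g := by
    intro y hy τ
    rw [ev_apply, ← tsum_mul_left]
    refine tsum_congr fun n => ?_
    have h3 : Real.exp (-(3 * ν) * y) = Real.exp (-(ν * y)) ^ 3 := by
      rw [← Real.exp_nat_mul]; congr 1; push_cast; ring
    simp only [F, gG]
    rw [hq y hy, ew_eq, h3]; push_cast; ring
  have hE0 : Summable fun n : ℤ => (1 + (n : ℝ) ^ 2) * xw σ n := exp_summable σ hσ
  have ha_sum : Summable fun n => ‖a n‖ := summable_of_ne_finset_zero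
    (s := Finset.Icc (-(k : ℤ)) (k : ℤ)) (by intro n hn; rw [ha n hn, norm_zero])
  have hlin : ∀ n y, 0 ≤ y → ‖lin n y‖ ≤ Real.exp 1 * ‖a n‖ := by
    intro n y hy
    simp only [lin]
    rw [norm_mul, Complex.norm_real, Real.norm_of_nonneg (Real.exp_pos _).le, mul_comm]
    gcongr
    nlinarith [nuKG_le ω n, nuKG_nonneg ω n]
  have hcore := core ω w w' F (fun n : ℤ => (1 + (n : ℝ) ^ 2) * xw σ n * ‖W‖)
    (fun n => Real.exp 1 * ‖a n‖ + ‖g n‖ / ν) (fun n => ‖g n‖) (hE0.mul_right _)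
    ((ha_sum.mul_left _).add ((X_summable g).div_const _)) (X_summable g)
    (by
      intro n y
      exact (lin_deriv (a n) (nuKG ω n) y).add
        (((md n).d1 _ (gG_GG ν (g n)) y).const_mul (xw σ n : ℂ)))
    (by
      intro n y
      refine (((lin_deriv (a n) (nuKG ω n) y).const_mul (-(nuKG ω n : ℂ))).add
        (((md n).d2 _ (gG_GG ν (g n)) y).const_mul (xw σ n : ℂ))).congr_deriv ?_
      simp only [w, F, lin, o1]
      by_cases hn : n ∈ Finset.Icc (-(k : ℤ)) (k : ℤ)
      · have h1 : (1 - (n : ℝ) ^ 2 * ω ^ 2) = nuKG ω n ^ 2 := by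
          unfold nuKG
          rw [Real.sq_sqrt ((sq_nonneg ν).trans (hin n hn))]
        have h1' : ((1 - (n : ℝ) ^ 2 * ω ^ 2 : ℝ) : ℂ) = (nuKG ω n : ℂ) ^ 2 := by
          rw [h1]; push_cast; rfl
        linear_combination (-(a n * ((Real.exp (nuKG ω n * (1 - y)) : ℝ) : ℂ))) * h1'
      · rw [ha n hn]; ring)
    (by
      intro n y hy
      have h1 := hWn n y hy.le
      have h2 : Real.exp (-(ν * y)) ≤ 1 := by
        rw [Real.exp_le_one_iff, neg_nonpos]; positivity
      have h3 : ‖W n‖ ≤ ‖W‖ := lp.norm_apply_le_norm (by simp) W n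
      have hx := xw_pos σ n
      rw [mul_assoc]
      refine mul_le_mul_of_nonneg_left (h1.trans ?_) (by positivity)
      refine mul_le_mul_of_nonneg_left ?_ hx.le
      calc _ ≤ 1 * ‖W‖ := by gcongr
        _ = _ := one_mul _)
    (by
      intro n y hy
      refine (norm_add_le _ _).trans (add_le_add ?_ (o2_norm md σ hν hσ.le g n y hy.le))
      rw [norm_mul, norm_neg, Complex.norm_real, Real.norm_of_nonneg (nuKG_nonneg ω n)]
      calc _ ≤ 1 * (Real.exp 1 * ‖a n‖) := by
            gcongr
            · exact nuKG_le ω n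
            · exact hlin n y hy.le
        _ = _ := one_mul _)
    (by
      intro n y hy
      simp only [F]
      rw [norm_mul, Complex.norm_real, Real.norm_of_nonneg (xw_pos σ n).le]
      have h2 : Real.exp (-(3 * ν) * y) ≤ 1 := by
        rw [Real.exp_le_one_iff]; nlinarith
      calc _ ≤ 1 * (‖g n‖ * 1) := by
            gcongr
            · exact xw_le σ hσ.le n
            · exact (gG_bound ν (g n) y).trans (by gcongr)
        _ = _ := by ring)
    u hu
  refine ⟨u, ?_, ?_, ?_, ?_, ‖W‖, ?_⟩
  · intro x hx τ
    have hx0 : (0 : ℝ) ≤ x := hx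
    have h := (hcore x (by linarith) τ).2
    rw [hFs (x + 1) (by linarith), hg, ev_NN σ hσ.le ν hν.le β K r0 hr0.le hβ W hW, ← huC] at h
    have hun : |u x τ| ≤ r0 := by
      have h1 : ‖((u x τ : ℝ) : ℂ)‖ ≤ 1 * ‖W‖ := by
        rw [huC, norm_mul]
        gcongr
        · exact ((qB ν hν.le).norm_coe_le_norm _).trans (qB_norm _ _)
        · exact ev_norm_le _ _ _ _ _
      rw [Complex.norm_real, Real.norm_eq_abs, one_mul] at h1
      exact h1.trans hW
    have hs : HasSum (fun m => ((β m * u x τ ^ (m + 3) : ℝ) : ℂ))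
        ((1 / 3 * (u x τ) ^ 3 + (f (u x τ)).re : ℝ) : ℂ) := Complex.hasSum_ofReal.2 (hfs _ hun)
    have h2 : ∑' m, (β m : ℂ) * ((u x τ : ℝ) : ℂ) ^ (m + 3)
        = ((1 / 3 * (u x τ) ^ 3 + (f (u x τ)).re : ℝ) : ℂ) := by
      rw [← hs.tsum_eq]
      refine tsum_congr fun m => ?_
      push_cast; rfl
    rw [h2] at h
    have h3 := Complex.ofReal_injective h
    linarith
  · intro x hx τ
    have hx0 : (0 : ℝ) ≤ x := hx
    apply Complex.ofReal_injective
    rw [hu x (by linarith), hu x (by linarith)]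
    simp only [em_period]
  · intro τ
    rw [hu 0 (by norm_num), zero_add]
    have hsa : HasSum (fun n => lin n 1 * em n τ) (linPart k (fun _ => 1) a τ) := by
      have := hasSum_sum_of_ne_finset_zero (L := SummationFilter.unconditional ℤ)
        (f := fun n => lin n 1 * em n τ)
        (s := Finset.Icc (-(k : ℤ)) (k : ℤ)) (by
          intro n hn
          simp only [lin]; rw [ha n hn]; ring)
      convert this using 1
      unfold linPart
      refine Finset.sum_congr rfl fun n _ => ?_
      simp [lin, em]
    have := hsa.add (o1_summable md σ hν hσ.le g 1 zero_le_one τ).hasSum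
    rw [← this.tsum_eq]
    refine tsum_congr fun n => ?_
    simp only [w]; ring
  · intro τ
    rw [(hcore 0 (by norm_num) τ).1, zero_add]
    have hsa : HasSum (fun n => (-(nuKG ω n : ℂ) * lin n 1) * em n τ)
        (linPart k (fun n => -nuKG ω n) a τ) := by
      have := hasSum_sum_of_ne_finset_zero (L := SummationFilter.unconditional ℤ)
        (f := fun n => (-(nuKG ω n : ℂ) * lin n 1) * em n τ)
        (s := Finset.Icc (-(k : ℤ)) (k : ℤ)) (by
          intro n hn
          simp only [lin]; rw [ha n hn]; ring)
      convert this using 1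
      unfold linPart
      refine Finset.sum_congr rfl fun n _ => ?_
      simp [lin, em]
    have := hsa.add (o2_summable md σ hν hσ.le g 1 zero_le_one τ).hasSum
    rw [← this.tsum_eq]
    refine tsum_congr fun n => ?_
    simp only [w']; ring
  · intro x hx
    have h1 : l1R (u x) ≤ ENNReal.ofReal (Real.exp (-(ν * (x + 1))) * ‖W‖) := by
      unfold l1R
      refine l1C_le _ (fun n => w n (x + 1)) _ _ ((X_hasSum W).mul_left _) ?_
        (fun τ => hu x (by linarith) τ)
      intro n
      refine (hWn n (x + 1) (by linarith)).trans ?_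
      have := xw_le σ hσ.le n
      have h0 : 0 ≤ Real.exp (-(ν * (x + 1))) * ‖W n‖ := by positivity
      nlinarith
    calc _ ≤ ENNReal.ofReal (Real.exp (ν * x)) * ENNReal.ofReal (Real.exp (-(ν * (x + 1))) * ‖W‖) := by
          gcongr
      _ = ENNReal.ofReal (Real.exp (ν * x) * (Real.exp (-(ν * (x + 1))) * ‖W‖)) := by
          rw [ENNReal.ofReal_mul (p := Real.exp (ν * x)) (Real.exp_pos _).le]
      _ ≤ _ := by
          apply ENNReal.ofReal_le_ofReal
          rw [← mul_assoc, ← Real.exp_add]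
          have : Real.exp (ν * x + -(ν * (x + 1))) ≤ 1 := by
            rw [Real.exp_le_one_iff]; linarith
          calc _ ≤ 1 * ‖W‖ := mul_le_mul_of_nonneg_right this (norm_nonneg W)
            _ = _ := one_mul _

end KG

namespace KG

lemma theMode_congr (κ κ' ν : ℝ) (hν : 0 < ν) (h : ν ^ 2 ≤ κ ∨ κ ≤ 0) (h' : ν ^ 2 ≤ κ' ∨ κ' ≤ 0)
    (e : κ = κ') : (theMode κ ν hν h).V = (theMode κ' ν hν h').V := by
  subst e; rfl

lemma Ew_even (σ ω : ℝ) (n : ℤ) : Ew σ ω (-n) = Ew σ ω n := by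
  unfold Ew; rw [abs_neg, nuKG_neg]

lemma th_even (ω ν : ℝ) (n : ℤ) : th ω ν (-n) = th ω ν n := by
  unfold th; rw [nuKG_neg]

lemma Ew_bound (k : ℕ) (ω : ℝ) : ∀ n ∈ Finset.Icc (-(k : ℤ)) (k : ℤ),
    |Ew (1 / ((k : ℝ) + 1)) ω n| ≤ Real.exp 2 := by
  intro n hn
  rw [Finset.mem_Icc] at hn
  have h1 : ((|n| : ℤ) : ℝ) ≤ k := by
    have : |n| ≤ (k : ℤ) := abs_le.2 hn
    exact_mod_cast this
  unfold Ew
  rw [← Real.exp_add, abs_of_pos (Real.exp_pos _)]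
  apply Real.exp_le_exp.2
  have h2 : 1 / ((k : ℝ) + 1) * ((|n| : ℤ) : ℝ) ≤ 1 := by
    rw [one_div, inv_mul_le_iff₀ (by positivity)]
    linarith
  linarith [nuKG_le ω n]

lemma reflect (f : ℂ → ℂ) (k : ℕ) (ω ν : ℝ) (a : ℤ → ℂ) (O1 O2 : ℝ → ℂ)
    (h : ∃ u : ℝ → ℝ → ℝ,
      IsTauKGSolutionOn f ω (Set.Ici 0) u ∧
      (∀ x ∈ Set.Ici (0 : ℝ), ∀ τ, u x (τ + 2 * Real.pi) = u x τ) ∧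
      (∀ τ, ((u 0 τ : ℝ) : ℂ) = linPart k (fun _ => 1) a τ + O1 τ) ∧
      (∀ τ, ((deriv (fun x => u x τ) 0 : ℝ) : ℂ)
          = linPart k (fun n => -nuKG ω n) a τ + O2 τ) ∧
      ∃ C : ℝ, ∀ x : ℝ, 0 ≤ x →
        ENNReal.ofReal (Real.exp (ν * x)) * l1R (u x) ≤ ENNReal.ofReal C) :
    ∃ u : ℝ → ℝ → ℝ,
      IsTauKGSolutionOn f ω (Set.Iic 0) u ∧
      (∀ x ∈ Set.Iic (0 : ℝ), ∀ τ, u x (τ + 2 * Real.pi) = u x τ) ∧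
      (∀ τ, ((u 0 τ : ℝ) : ℂ) = linPart k (fun _ => 1) a τ + O1 τ) ∧
      (∀ τ, ((deriv (fun x => u x τ) 0 : ℝ) : ℂ)
          = linPart k (fun n => nuKG ω n) a τ + -O2 τ) ∧
      ∃ C : ℝ, ∀ x : ℝ, x ≤ 0 →
        ENNReal.ofReal (Real.exp (-(ν * x))) * l1R (u x) ≤ ENNReal.ofReal C := by
  obtain ⟨u, h1, h2, h3, h4, C, h5⟩ := h
  have hd : ∀ τ s, deriv (fun s' => u (-s') τ) s = -deriv (fun s' => u s' τ) (-s) := fun τ s =>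
    deriv_comp_neg (fun s' => u s' τ) s
  refine ⟨fun x τ => u (-x) τ, ?_, ?_, ?_, ?_, C, ?_⟩
  · intro x hx τ
    have hx0 : x ≤ 0 := hx
    have h := h1 (-x) (by simpa using hx0) τ
    have hdd : deriv (fun s => deriv (fun s' => u (-s') τ) s) x
        = deriv (fun s => deriv (fun s' => u s' τ) s) (-x) := by
      simp only [hd]
      rw [deriv.fun_neg, deriv_comp_neg (fun s => deriv (fun s' => u s' τ) s) x, neg_neg]
    simp only []
    rw [hdd]
    exact h
  · intro x hx τ
    have hx0 : x ≤ 0 := hx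
    exact h2 (-x) (by simpa using hx0) τ
  · intro τ
    simpa using h3 τ
  · intro τ
    have := h4 τ
    rw [hd, neg_zero, Complex.ofReal_neg, this, neg_add]
    congr 1
    unfold linPart
    rw [← Finset.sum_neg_distrib]
    refine Finset.sum_congr rfl fun n _ => ?_
    push_cast; ring
  · intro x hx
    have := h5 (-x) (by linarith)
    rw [mul_neg] at this
    exact this

lemma est_arith (K S e ν A B D wa wb wd N : ℝ) (hK : 0 < K) (hS : 0 < S) (he : 0 < e) (hν : 0 < ν)
    (hwa0 : 0 ≤ wa) (hwb0 : 0 ≤ wb) (hwd0 : 0 ≤ wd) (hD : 0 ≤ D)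
    (hwa : wa ≤ 2 * (e * A)) (hwb : wb ≤ 2 * (e * B)) (hwd : wd ≤ 2 * (e * D))
    (hN : N ≤ K * S * (max wa wb) ^ 2 * wd) :
    N / ν ^ 2 + ν⁻¹ * (N / ν) ≤ 16 * K * S * e ^ 3 / ν ^ 2 * (A ^ 2 + B ^ 2) * D := by
  have h1 : (max wa wb) ^ 2 ≤ 4 * e ^ 2 * (A ^ 2 + B ^ 2) := by
    have ha : wa ^ 2 ≤ (2 * (e * A)) ^ 2 := by gcongr
    have hb : wb ^ 2 ≤ (2 * (e * B)) ^ 2 := by gcongr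
    have hA : 0 ≤ (e * A) ^ 2 := sq_nonneg _
    have hB : 0 ≤ (e * B) ^ 2 := sq_nonneg _
    rcases max_cases wa wb with h | h <;> rw [h.1] <;> nlinarith
  have h2 : N ≤ K * S * (4 * e ^ 2 * (A ^ 2 + B ^ 2)) * (2 * (e * D)) := by
    refine hN.trans ?_
    gcongr
  calc _ = 2 * N / ν ^ 2 := by field_simp; ring
    _ ≤ 2 * (K * S * (4 * e ^ 2 * (A ^ 2 + B ^ 2)) * (2 * (e * D))) / ν ^ 2 := by gcongr
    _ = _ := by ring

lemma aNorm_nonneg (k : ℕ) (a : ℤ → ℂ) : 0 ≤ aNorm k a := Finset.sum_nonneg fun _ _ => norm_nonneg _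

lemma main (f : ℂ → ℂ) (β : ℕ → ℝ) (K r0 : ℝ) (hK : 0 < K) (hr0 : 0 < r0)
    (hβ : ∀ m, |β m| * r0 ^ m ≤ K * (1 / 2) ^ m)
    (hfs : ∀ x : ℝ, |x| ≤ r0 → HasSum (fun m => β m * x ^ (m + 3)) (1 / 3 * x ^ 3 + (f x).re))
    (δ : ℝ) (hδ : 0 < δ) (hδr : δ ≤ r0) (hδ2 : K * S0 * δ ^ 2 ≤ 1 / 2)
    (k : ℕ) (ω ν : ℝ) (hν : 0 < ν) (hν1 : ν ≤ 1)
    (hin : ∀ n ∈ Finset.Icc (-(k : ℤ)) (k : ℤ), ν ^ 2 ≤ 1 - (n : ℝ) ^ 2 * ω ^ 2)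
    (hout : ∀ n : ℤ, n ∉ Finset.Icc (-(k : ℤ)) (k : ℤ) → 1 - (n : ℝ) ^ 2 * ω ^ 2 ≤ 0) :
    ∃ O1 O2 : (ℤ → ℂ) → ℝ → ℂ,
      (∀ τ, O1 (fun _ => 0) τ = 0 ∧ O2 (fun _ => 0) τ = 0) ∧
      (∀ a b : ℤ → ℂ, Adm k (δ / (2 * Real.exp 2) * ν) a → Adm k (δ / (2 * Real.exp 2) * ν) b →
        l1C (fun τ => O1 a τ - O1 b τ)
            + ENNReal.ofReal ν⁻¹ * l1C (fun τ => O2 a τ - O2 b τ)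
          ≤ ENNReal.ofReal
              (16 * K * S0 * Real.exp 2 ^ 3 / ν ^ 2 * (aNorm k a ^ 2 + aNorm k b ^ 2)
                * aNorm k fun n => a n - b n)) ∧
      ∀ a : ℤ → ℂ, Adm k (δ / (2 * Real.exp 2) * ν) a →
        ∃ u : ℝ → ℝ → ℝ,
          IsTauKGSolutionOn f ω (Set.Ici 0) u ∧
          (∀ x ∈ Set.Ici (0 : ℝ), ∀ τ, u x (τ + 2 * Real.pi) = u x τ) ∧
          (∀ τ, ((u 0 τ : ℝ) : ℂ) = linPart k (fun _ => 1) a τ + O1 a τ) ∧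
          (∀ τ, ((deriv (fun x => u x τ) 0 : ℝ) : ℂ)
              = linPart k (fun n => -nuKG ω n) a τ + O2 a τ) ∧
          ∃ C : ℝ, ∀ x : ℝ, 0 ≤ x →
            ENNReal.ofReal (Real.exp (ν * x)) * l1R (u x) ≤ ENNReal.ofReal C := by
  have hκ : ∀ n : ℤ, ν ^ 2 ≤ 1 - (n : ℝ) ^ 2 * ω ^ 2 ∨ 1 - (n : ℝ) ^ 2 * ω ^ 2 ≤ 0 := fun n =>
    if h : n ∈ Finset.Icc (-(k : ℤ)) (k : ℤ) then Or.inl (hin n h) else Or.inr (hout n h)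
  have hδν : δ * ν ≤ r0 := by nlinarith
  let md : ∀ n : ℤ, Mode (1 - (n : ℝ) ^ 2 * ω ^ 2) ν := fun n => theMode _ ν hν (hκ n)
  have hm : ∀ (n : ℤ) G x, (md (-n)).V G x = (md n).V G x := by
    intro n G x
    have := theMode_congr _ _ ν hν (hκ (-n)) (hκ n) (by push_cast; ring)
    exact congrFun (congrFun this G) x
  set σ : ℝ := 1 / ((k : ℝ) + 1) with hσd
  have hσ : 0 < σ := by positivity
  let La : (ℤ → ℂ) → X := fun a => Lx k (Ew σ ω) (th ω ν) (th_nonneg ω ν) a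
  have hLn : ∀ a, ‖La a‖ ≤ Real.exp 2 * aNorm k a := fun a =>
    Lx_norm k (Ew σ ω) (th ω ν) (th_nonneg ω ν) _ (Ew_bound k ω) a
  have hex : ∀ a : ℤ → ℂ, ∃ W : X, Adm k (δ / (2 * Real.exp 2) * ν) a →
      ‖W‖ ≤ δ * ν ∧ Sym W ∧ La a + TX md (NN σ hσ.le ν hν.le β W) = W := by
    intro a
    by_cases ha : Adm k (δ / (2 * Real.exp 2) * ν) a
    · have hL : ‖La a‖ ≤ δ * ν / 2 := by
        refine (hLn a).trans ?_
        calc _ ≤ Real.exp 2 * (δ / (2 * Real.exp 2) * ν) := by gcongr; exact ha.2.2.le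
          _ = _ := by field_simp
      obtain ⟨W, hW⟩ := fix_exists σ hσ.le ν hν β K r0 hK hr0 hβ md hm δ hδ hδν hδ2 (La a)
        (Lx_Sym k (Ew σ ω) (th ω ν) (th_nonneg ω ν) (Ew_even σ ω) (th_even ω ν) a ha.1) hL
      exact ⟨W, fun _ => hW⟩
    · exact ⟨0, fun h => absurd h ha⟩
  choose W hW using hex
  have hδν0 : 0 ≤ δ * ν := by positivity
  have e0 : (0 : X) + TX md (NN σ hσ.le ν hν.le β 0) = 0 := by
    rw [NN_zero, zero_add]
    have := TX_norm md (0 : X)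
    rw [norm_zero, zero_div] at this
    exact norm_le_zero_iff.1 this
  have hWn : ∀ a, Adm k (δ / (2 * Real.exp 2) * ν) a → ‖W a‖ ≤ 2 * (Real.exp 2 * aNorm k a) := by
    intro a ha
    have h := fix_diff σ hσ.le ν hν β K r0 hK hr0 hβ md δ hδν hδ2 (La a) 0 (W a) 0 (hW a ha).1
      (by rw [norm_zero]; exact hδν0) (hW a ha).2.2 e0
    rw [sub_zero, sub_zero] at h
    linarith [hLn a]
  have hW0 : W (fun _ => 0) = 0 := by
    have hA : Adm k (δ / (2 * Real.exp 2) * ν) (fun _ => 0) := by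
      refine ⟨fun n => by simp, fun n _ => rfl, ?_⟩
      have : aNorm k (fun _ => 0) = 0 := by simp [aNorm]
      rw [this]; positivity
    have := hWn _ hA
    rw [show aNorm k (fun _ => 0) = 0 by simp [aNorm], mul_zero, mul_zero] at this
    exact norm_le_zero_iff.1 this
  refine ⟨fun a τ => ∑' n, o1 md σ (NN σ hσ.le ν hν.le β (W a)) n 1 * em n τ,
    fun a τ => ∑' n, o2 md σ (NN σ hσ.le ν hν.le β (W a)) n 1 * em n τ, ?_, ?_, ?_⟩
  · intro τ
    simp only [hW0, NN_zero]
    have z : ∀ n : ℤ, ‖(0 : X) n‖ = 0 := fun n => norm_zero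
    have z1 : ∀ n, o1 md σ 0 n 1 = 0 := fun n => by
      have := o1_norm md σ hν hσ.le 0 n 1 zero_le_one
      rw [z, zero_div] at this
      exact norm_le_zero_iff.1 this
    have z2 : ∀ n, o2 md σ 0 n 1 = 0 := fun n => by
      have := o2_norm md σ hν hσ.le 0 n 1 zero_le_one
      rw [z, zero_div] at this
      exact norm_le_zero_iff.1 this
    simp [z1, z2]
  · intro a b ha hb
    set N := ‖NN σ hσ.le ν hν.le β (W a) - NN σ hσ.le ν hν.le β (W b)‖ with hN
    have h1 := O1_diff md σ hν hσ.le (NN σ hσ.le ν hν.le β (W a)) (NN σ hσ.le ν hν.le β (W b))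
    have h2 := O2_diff md σ hν hσ.le (NN σ hσ.le ν hν.le β (W a)) (NN σ hσ.le ν hν.le β (W b))
    have hd : ‖W a - W b‖ ≤ 2 * (Real.exp 2 * aNorm k fun n => a n - b n) := by
      have h := fix_diff σ hσ.le ν hν β K r0 hK hr0 hβ md δ hδν hδ2 (La a) (La b) (W a) (W b)
        (hW a ha).1 (hW b hb).1 (hW a ha).2.2 (hW b hb).2.2
      have e : La a - La b = La (fun n => a n - b n) := Lx_sub k (Ew σ ω) (th ω ν) (th_nonneg ω ν) a b
      rw [e] at h
      linarith [hLn (fun n => a n - b n)]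
    have hNN := NN_diff σ hσ.le ν hν.le β K r0 hr0.le hβ (W a) (W b) (max ‖W a‖ ‖W b‖)
      ((max_le (hW a ha).1 (hW b hb).1).trans hδν) (le_max_left _ _) (le_max_right _ _)
    have hfin := est_arith K S0 (Real.exp 2) ν _ _ _ _ _ _ N hK S0_pos (Real.exp_pos _) hν
      (norm_nonneg _) (norm_nonneg _) (norm_nonneg _) (aNorm_nonneg _ _) (hWn a ha) (hWn b hb) hd hNN
    refine le_trans (add_le_add h1 (mul_le_mul' le_rfl h2)) ?_
    rw [← ENNReal.ofReal_mul (by positivity), ← ENNReal.ofReal_add (by positivity) (by positivity)]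
    exact ENNReal.ofReal_le_ofReal hfin
  · intro a ha
    refine stable_sol f β K r0 hr0 hβ hfs k ω ν hν hin md σ hσ a ?_ (W a) ((hW a ha).1.trans hδν)
      (hW a ha).2.1 (hW a ha).2.2
    intro n hn
    apply ha.2.1
    by_contra hc
    exact hn (Finset.mem_Icc.2 (abs_le.1 (not_lt.1 hc)))

end KG

/-- parameterization of the local stable/unstable manifolds of `0` for
`ω ∈ J_k(ε₀)`, with uniform size `ρ·ν_k` and cubic Lipschitz estimates. -/
theorem statement18 (f : ℂ → ℂ) (hf : AssumptionA f) :
    ∃ ρ : ℝ, 0 < ρ ∧ ∃ M : ℝ, 0 < M ∧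
      ∀ ε₀ : ℝ, 0 < ε₀ → ε₀ < 1 / 2 → ∀ k : ℕ, ∀ ω ∈ Jset ε₀ k,
        ∃ Ω1s Ω2s Ω1u Ω2u : (ℤ → ℂ) → ℝ → ℂ,
          -- (i) the parameterizations vanish at `a = 0`
          (∀ τ, Ω1s (fun _ => 0) τ = 0 ∧ Ω2s (fun _ => 0) τ = 0 ∧
            Ω1u (fun _ => 0) τ = 0 ∧ Ω2u (fun _ => 0) τ = 0) ∧
          -- (ii) the cubic Lipschitz estimates
          (∀ a b : ℤ → ℂ, Adm k (ρ * nuKG ω k) a → Adm k (ρ * nuKG ω k) b →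
            (l1C (fun τ => Ω1s a τ - Ω1s b τ)
                + ENNReal.ofReal (nuKG ω k)⁻¹ * l1C (fun τ => Ω2s a τ - Ω2s b τ)
              ≤ ENNReal.ofReal
                  (M / nuKG ω k ^ 2 * (aNorm k a ^ 2 + aNorm k b ^ 2)
                    * aNorm k fun n => a n - b n)) ∧
            (l1C (fun τ => Ω1u a τ - Ω1u b τ)
                + ENNReal.ofReal (nuKG ω k)⁻¹ * l1C (fun τ => Ω2u a τ - Ω2u b τ)
              ≤ ENNReal.ofReal
                  (M / nuKG ω k ^ 2 * (aNorm k a ^ 2 + aNorm k b ^ 2)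
                    * aNorm k fun n => a n - b n))) ∧
          -- (iii) `Ω^s(a,·)` is the initial datum of a solution on `x ∈ [0,∞)` decaying
          -- exponentially at rate `ν_k` as `x → +∞`
          (∀ a : ℤ → ℂ, Adm k (ρ * nuKG ω k) a →
            ∃ u : ℝ → ℝ → ℝ,
              IsTauKGSolutionOn f ω (Set.Ici 0) u ∧
              (∀ x ∈ Set.Ici (0 : ℝ), ∀ τ, u x (τ + 2 * Real.pi) = u x τ) ∧
              (∀ τ, ((u 0 τ : ℝ) : ℂ) = linPart k (fun _ => 1) a τ + Ω1s a τ) ∧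
              (∀ τ, ((deriv (fun x => u x τ) 0 : ℝ) : ℂ)
                  = linPart k (fun n => -nuKG ω n) a τ + Ω2s a τ) ∧
              ∃ C : ℝ, ∀ x : ℝ, 0 ≤ x →
                ENNReal.ofReal (Real.exp (nuKG ω k * x)) * l1R (u x)
                  ≤ ENNReal.ofReal C) ∧
          -- and `Ω^u(a,·)` is the initial datum of a solution on `x ∈ (−∞,0]` decaying
          -- exponentially at rate `ν_k` as `x → −∞`
          (∀ a : ℤ → ℂ, Adm k (ρ * nuKG ω k) a →
            ∃ u : ℝ → ℝ → ℝ,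
              IsTauKGSolutionOn f ω (Set.Iic 0) u ∧
              (∀ x ∈ Set.Iic (0 : ℝ), ∀ τ, u x (τ + 2 * Real.pi) = u x τ) ∧
              (∀ τ, ((u 0 τ : ℝ) : ℂ) = linPart k (fun _ => 1) a τ + Ω1u a τ) ∧
              (∀ τ, ((deriv (fun x => u x τ) 0 : ℝ) : ℂ)
                  = linPart k (fun n => nuKG ω n) a τ + Ω2u a τ) ∧
              ∃ C : ℝ, ∀ x : ℝ, x ≤ 0 →
                ENNReal.ofReal (Real.exp (-(nuKG ω k * x))) * l1R (u x)
                  ≤ ENNReal.ofReal C) := by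
  obtain ⟨β, K, r0, hr0, hK, hβ, hfs⟩ := KG.f_series f hf
  have hS := KG.S0_pos
  obtain ⟨δ, hδ, hδr, hδ2⟩ : ∃ δ : ℝ, 0 < δ ∧ δ ≤ r0 ∧ K * KG.S0 * δ ^ 2 ≤ 1 / 2 := by
    have hc : 0 < K * KG.S0 := by positivity
    refine ⟨min r0 (min 1 (1 / (2 * (K * KG.S0)))), ?_, min_le_left _ _, ?_⟩
    · exact lt_min hr0 (lt_min one_pos (by positivity))
    · set d := min r0 (min 1 (1 / (2 * (K * KG.S0))))
      have d0 : 0 < d := lt_min hr0 (lt_min one_pos (by positivity))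
      have d1 : d ≤ 1 := (min_le_right _ _).trans (min_le_left _ _)
      have d2 : d ≤ 1 / (2 * (K * KG.S0)) := (min_le_right _ _).trans (min_le_right _ _)
      have d3 : d ^ 2 ≤ 1 / (2 * (K * KG.S0)) := by nlinarith
      calc _ ≤ K * KG.S0 * (1 / (2 * (K * KG.S0))) := by gcongr
        _ = _ := by field_simp
  refine ⟨δ / (2 * Real.exp 2), by positivity, 16 * K * KG.S0 * Real.exp 2 ^ 3, by positivity, ?_⟩
  intro ε₀ hε _ k ω hω
  obtain ⟨hν, hν1, hin, hout⟩ := KG.J_facts ε₀ k ω hω hε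
  obtain ⟨O1, O2, h1, h2, h3⟩ := KG.main f β K r0 hK hr0 hβ hfs δ hδ hδr hδ2 k ω (nuKG ω k) hν hν1
    hin hout
  refine ⟨O1, O2, O1, fun a τ => -O2 a τ, ?_, ?_, h3, ?_⟩
  · intro τ
    obtain ⟨z1, z2⟩ := h1 τ
    exact ⟨z1, z2, z1, by simp [z2]⟩
  · intro a b ha hb
    refine ⟨h2 a b ha hb, ?_⟩
    have e : (fun τ => -O2 a τ - -O2 b τ) = fun τ => -(O2 a τ - O2 b τ) := by
      funext τ; ring
    simp only [e]
    rw [KG.l1C_neg (fun τ => O2 a τ - O2 b τ)]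
    exact h2 a b ha hb
  · intro a ha
    exact KG.reflect f k ω (nuKG ω k) a (O1 a) (O2 a) (h3 a ha)
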